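/- arXiv:2305.01221 — 9 statements merged into one kernel-verified Lean document; each statement's English description precedes it below -/
import Mathlib

section
/- Let n ≥ 2 and let B be the n×n matrix with entries B_{ij} = min(i,j)·(n+1−max(i,j))/(n+1) (the inverse of the type-A Cartan matrix A_n). Then for every σ ∈ ℝ^{n+1}: ∑_{i=1}^{n} ∑_{j=1}^{n} B_{ij} · (∑_{t∈I} K_{it} σ_t) · (∑_{s∈I} K_{js} σ_s) = ∑_{i=1}^{n+1} (σ_i − σ_{i+1})², where σ_{n+2} = σ_1. -/
open Finset

/-- The generalized Cartan matrix of type `A_n^{(1)}`, with indices read cyclically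
(`K i i = 2`, `K i j = -1` when `i,j` are cyclically adjacent, `0` otherwise). -/
noncomputable def affA (n : ℕ) (i j : ZMod (n + 1)) : ℝ :=
  if i = j then 2 else if i = j + 1 ∨ j = i + 1 then -1 else 0

/-- The 1-based entries of the inverse of the type-A Cartan matrix `A_n`:
`B_{ij} = min(i,j)·(n+1-max(i,j))/(n+1)`. -/
noncomputable def invA (n i j : ℕ) : ℝ :=
  ((min i j : ℕ) : ℝ) * ((n : ℝ) + 1 - ((max i j : ℕ) : ℝ)) / ((n : ℝ) + 1)

theorem sum_affA_mul (n : ℕ) (hn : 2 ≤ n) (σ : ZMod (n + 1) → ℝ) (i : ZMod (n + 1)) :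
    ∑ t : ZMod (n + 1), affA n i t * σ t = 2 * σ i - σ (i - 1) - σ (i + 1) := by
  have h1 : (1 : ZMod (n + 1)) ≠ 0 := by
    intro h
    have h' := (ZMod.natCast_eq_zero_iff 1 (n + 1)).1 (by exact_mod_cast h)
    have := Nat.le_of_dvd (by norm_num) h'
    omega
  have h2 : (1 : ZMod (n + 1)) + 1 ≠ 0 := by
    intro h
    have h' := (ZMod.natCast_eq_zero_iff 2 (n + 1)).1 (by push_cast; rw [← h]; norm_num)
    have := Nat.le_of_dvd (by norm_num) h'
    omega
  have key : ∀ t, affA n i t * σ t = (if t = i then 2 * σ t else 0)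
      - (if t = i - 1 then σ t else 0) - (if t = i + 1 then σ t else 0) := by
    intro t
    by_cases ha : t = i
    · subst ha
      have hd : t ≠ t - 1 := fun h => h1 (by linear_combination h)
      simp [affA, h1, hd]
    by_cases hb : t = i - 1
    · subst hb
      have hc : i - 1 ≠ i + 1 := fun h => h2 (by linear_combination -h)
      simp [affA, hc, ha, Ne.symm ha]
    by_cases hc : t = i + 1
    · subst hc
      have hd : i + 1 ≠ i - 1 := fun h => h2 (by linear_combination h)
      simp [affA, h1, hd]
    · have hd : i ≠ t + 1 := fun h => hb (by rw [h]; ring)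
      simp [affA, ha, hb, hc, hd, Ne.symm ha]
  simp_rw [key, Finset.sum_sub_distrib]
  simp

/-- Discrete Green's second identity for the one-dimensional Laplacian. -/
theorem sum_range_mul_laplacian (w v : ℕ → ℝ) (m : ℕ) :
    ∑ j ∈ range m, w (j + 1) * (2 * v (j + 1) - v j - v (j + 2)) =
      ∑ j ∈ range m, (2 * w (j + 1) - w j - w (j + 2)) * v (j + 1)
        + w (m + 1) * v m - w m * v (m + 1) - w 1 * v 0 + w 0 * v 1 := by
  induction m with
  | zero => simp
  | succ k ih => rw [sum_range_succ, sum_range_succ, ih]; ring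

/-- Discrete Green's first identity for the one-dimensional Laplacian. -/
theorem sum_range_laplacian_mul_sub (u : ℕ → ℝ) (c : ℝ) (m : ℕ) :
    ∑ i ∈ range m, (2 * u (i + 1) - u i - u (i + 2)) * (u (i + 1) - c) =
      ∑ i ∈ range (m + 1), (u i - u (i + 1)) ^ 2
        + (u m - u (m + 1)) * (u (m + 1) - c) - (u 0 - u 1) * (u 0 - c) := by
  induction m with
  | zero => simp; ring
  | succ k ih => rw [sum_range_succ, sum_range_succ _ (k + 1), ih]; ring

theorem laplacian_invA (n i j : ℕ) :
    2 * invA n i (j + 1) - invA n i j - invA n i (j + 2) = if j + 1 = i then 1 else 0 := by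
  have h0 : (n : ℝ) + 1 ≠ 0 := by positivity
  unfold invA
  rcases lt_trichotomy (j + 1) i with h | h | h
  · rw [if_neg h.ne, min_eq_right h.le, max_eq_left h.le, min_eq_right (by omega : j ≤ i),
      max_eq_left (by omega : j ≤ i), min_eq_right (by omega : j + 2 ≤ i),
      max_eq_left (by omega : j + 2 ≤ i)]
    push_cast
    ring
  · subst h
    rw [if_pos rfl, min_self, max_self, min_eq_right (by omega : j ≤ j + 1),
      max_eq_left (by omega : j ≤ j + 1), min_eq_left (by omega : j + 1 ≤ j + 2),
      max_eq_right (by omega : j + 1 ≤ j + 2)]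
    push_cast
    field_simp
    ring
  · rw [if_neg h.ne', min_eq_left h.le, max_eq_right h.le, min_eq_left (by omega : i ≤ j),
      max_eq_right (by omega : i ≤ j), min_eq_left (by omega : i ≤ j + 2),
      max_eq_right (by omega : i ≤ j + 2)]
    push_cast
    ring

theorem sum_range_invA_mul_laplacian (n i : ℕ) (hi : i < n) (v : ℕ → ℝ) (hv : v (n + 1) = v 0) :
    ∑ j ∈ range n, invA n (i + 1) (j + 1) * (2 * v (j + 1) - v j - v (j + 2)) =
      v (i + 1) - v 0 := by
  have h0 : (n : ℝ) + 1 ≠ 0 := by positivity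
  rw [sum_range_mul_laplacian (invA n (i + 1)) v n]
  simp_rw [laplacian_invA, Nat.add_right_cancel_iff, ite_mul, one_mul, zero_mul]
  rw [sum_ite_eq' (range n) i (fun j => v (j + 1)), if_pos (mem_range.2 hi), hv]
  unfold invA
  rw [min_eq_left (by omega : i + 1 ≤ n + 1), max_eq_right (by omega : i + 1 ≤ n + 1),
    min_eq_left (by omega : i + 1 ≤ n), max_eq_right (by omega : i + 1 ≤ n),
    min_eq_right (by omega : 1 ≤ i + 1), max_eq_left (by omega : 1 ≤ i + 1),
    min_eq_right (by omega : 0 ≤ i + 1)]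
  push_cast
  field_simp
  ring

theorem ZMod.sum_eq_sum_range {M : Type*} [AddCommMonoid M] (n : ℕ) (f : ZMod (n + 1) → M) :
    ∑ i, f i = ∑ k ∈ range (n + 1), f k := by
  rw [← Fin.sum_univ_eq_sum_range (fun k : ℕ => f k) (n + 1)]
  exact Fintype.sum_congr _ _ fun i : Fin (n + 1) =>
    congrArg f (ZMod.natCast_zmod_val (n := n + 1) i).symm

/-- `∑_{i,j=1}^n B_{ij} (∑_{t∈I} K_{it} σ_t)(∑_{s∈I} K_{js} σ_s)
      = ∑_{i=1}^{n+1} (σ_i - σ_{i+1})²` (indices of `σ` cyclic mod `n+1`). -/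
theorem invA_quadratic_identity (n : ℕ) (hn : 2 ≤ n) (σ : ZMod (n + 1) → ℝ) :
    ∑ i ∈ Finset.Icc 1 n, ∑ j ∈ Finset.Icc 1 n,
      invA n i j * (∑ t : ZMod (n + 1), affA n (i : ZMod (n + 1)) t * σ t) *
        (∑ s : ZMod (n + 1), affA n (j : ZMod (n + 1)) s * σ s)
      = ∑ i : ZMod (n + 1), (σ i - σ (i + 1)) ^ 2 := by
  set u : ℕ → ℝ := fun k => σ k with hu
  have hper : u (n + 1) = u 0 := by
    simp only [hu]
    rw [ZMod.natCast_self, Nat.cast_zero]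
  have hrow : ∀ k : ℕ, ∑ t : ZMod (n + 1), affA n ((k + 1 : ℕ) : ZMod (n + 1)) t * σ t =
      2 * u (k + 1) - u k - u (k + 2) := by
    intro k
    rw [sum_affA_mul n hn]
    simp only [hu]
    push_cast
    rw [add_sub_cancel_right, add_assoc, one_add_one_eq_two]
  have hIcc : ∀ f : ℕ → ℝ, ∑ i ∈ Icc 1 n, f i = ∑ i ∈ range n, f (i + 1) := by
    intro f
    rw [range_eq_Ico, sum_Ico_add' f 0 n 1]
    rfl
  have hinner : ∀ i ∈ range n,
      ∑ j ∈ range n, invA n (i + 1) (j + 1) * (2 * u (i + 1) - u i - u (i + 2)) *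
        (2 * u (j + 1) - u j - u (j + 2)) =
      (2 * u (i + 1) - u i - u (i + 2)) * (u (i + 1) - u 0) := by
    intro i hi
    rw [← sum_range_invA_mul_laplacian n i (mem_range.1 hi) u hper, mul_sum]
    exact sum_congr rfl fun j _ => by ring
  simp_rw [hIcc, hrow]
  rw [sum_congr rfl hinner, sum_range_laplacian_mul_sub, hper, ZMod.sum_eq_sum_range]
  simp [hu]
end

section
/- Let n ≥ 2 and let m : I → ℕ (indices understood cyclically modulo n+1) satisfy ∑_{i=1}^{n+1} (m_i − m_{i+1})² = 2·m_j for some fixed j ∈ I. Then for every i₀ ∈ I with i₀ ≠ j one has m_{i₀−1}² + m_{i₀+1}² + ∑_{i∈I, i∉{i₀−1, i₀}} (m_i − m_{i+1})² ≥ 2·m_j. -/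
open Finset

/-- The sum of squared increments of an integer sequence bounds its total increase. -/
lemma sub_le_sum_range_sq_sub (g : ℕ → ℤ) (k : ℕ) :
    g k - g 0 ≤ ∑ t ∈ range k, (g t - g (t + 1)) ^ 2 := by
  rw [← Finset.sum_range_sub]
  refine Finset.sum_le_sum fun t _ => ?_
  rw [← neg_sub (g t), ← neg_sq]
  exact Int.le_self_sq _

/-- The sum of squared increments of an integer sequence bounds its total decrease. -/
lemma sub_le_sum_range_sq_sub' (g : ℕ → ℤ) (k : ℕ) :
    g 0 - g k ≤ ∑ t ∈ range k, (g t - g (t + 1)) ^ 2 := by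
  rw [← Finset.sum_range_sub']
  exact Finset.sum_le_sum fun t _ => Int.le_self_sq _

lemma ZMod.sum_eq_sum_range_add {M : Type*} [AddCommMonoid M] (n : ℕ) (a : ZMod (n + 1))
    (F : ZMod (n + 1) → M) :
    ∑ i, F i = ∑ t ∈ range (n + 1), F (a + (t : ZMod (n + 1))) := by
  rw [← Equiv.sum_comp (Equiv.addLeft a) F]
  refine Finset.sum_nbij' ZMod.val (fun t => (t : ZMod (n + 1))) ?_ ?_ ?_ ?_ ?_
  · intro x _
    exact mem_range.2 (ZMod.val_lt x)
  · simp
  · simp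
  · intro t ht
    exact ZMod.val_cast_of_lt (mem_range.1 ht)
  · simp

/-- The sum of squared increments of an integer function around a cycle is at least twice the
difference of any two of its values. -/
lemma two_mul_sub_le_sum_sq_sub (n : ℕ) (f : ZMod (n + 1) → ℤ) (a j : ZMod (n + 1)) :
    2 * (f j - f a) ≤ ∑ i, (f i - f (i + 1)) ^ 2 := by
  obtain ⟨l, hl⟩ : ∃ l, n + 1 = (j - a).val + l :=
    Nat.exists_eq_add_of_le (ZMod.val_lt (j - a)).le
  have hj : a + ((j - a).val : ZMod (n + 1)) = j := by simp
  have ha : a + (((j - a).val + l : ℕ) : ZMod (n + 1)) = a := by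
    rw [← hl, ZMod.natCast_self, add_zero]
  have hsum := ZMod.sum_eq_sum_range_add n a fun i => (f i - f (i + 1)) ^ 2
  generalize (j - a).val = k at hl hj ha
  have up := sub_le_sum_range_sq_sub (fun t : ℕ => f (a + (t : ZMod (n + 1)))) k
  have down := sub_le_sum_range_sq_sub' (fun t : ℕ => f (a + ((k + t : ℕ) : ZMod (n + 1)))) l
  have hsplit : range (n + 1) = range (k + l) := by rw [hl]
  rw [hsum, hsplit, Finset.sum_range_add]
  simp only [ha, hj, Nat.cast_zero, add_zero] at up down
  simp only [Nat.cast_add, Nat.cast_one, add_assoc] at up down ⊢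
  linarith

/-- If `m : I → ℕ` (indices cyclic mod `n+1`) satisfies
`∑_{i=1}^{n+1} (m_i - m_{i+1})² = 2 m_j`, then for every `i₀ ≠ j`,
`m_{i₀-1}² + m_{i₀+1}² + ∑_{i ∉ {i₀-1, i₀}} (m_i - m_{i+1})² ≥ 2 m_j`. -/
theorem cyclic_square_sum_lower_bound (n : ℕ) (hn : 2 ≤ n) (m : ZMod (n + 1) → ℕ)
    (j : ZMod (n + 1))
    (h : ∑ i : ZMod (n + 1), ((m i : ℤ) - (m (i + 1) : ℤ)) ^ 2 = 2 * (m j : ℤ)) :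
    ∀ i₀ : ZMod (n + 1), i₀ ≠ j →
      (m (i₀ - 1) : ℤ) ^ 2 + (m (i₀ + 1) : ℤ) ^ 2 +
          ∑ i ∈ Finset.univ \ {i₀ - 1, i₀}, ((m i : ℤ) - (m (i + 1) : ℤ)) ^ 2
        ≥ 2 * (m j : ℤ) := by
  intro i₀ hi₀
  have : Fact (1 < n + 1) := ⟨by omega⟩
  have hpred : i₀ - 1 ≠ i₀ := by simp
  have hsucc : i₀ + 1 ≠ i₀ := by simp
  have key := two_mul_sub_le_sum_sq_sub n (Function.update (fun i => (m i : ℤ)) i₀ 0) i₀ j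
  rw [← Finset.sum_sdiff (Finset.subset_univ {i₀ - 1, i₀}), Finset.sum_pair hpred,
    sub_add_cancel, Function.update_self, Function.update_of_ne hpred,
    Function.update_of_ne hsucc, Function.update_of_ne hi₀.symm] at key
  have hcongr : ∑ i ∈ Finset.univ \ {i₀ - 1, i₀},
      (Function.update (fun i => (m i : ℤ)) i₀ 0 i -
        Function.update (fun i => (m i : ℤ)) i₀ 0 (i + 1)) ^ 2 =
      ∑ i ∈ Finset.univ \ {i₀ - 1, i₀}, ((m i : ℤ) - (m (i + 1) : ℤ)) ^ 2 := by
    refine Finset.sum_congr rfl fun i hi => ?_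
    simp only [mem_sdiff, mem_univ, true_and, mem_insert, mem_singleton, not_or] at hi
    rw [Function.update_of_ne hi.2,
      Function.update_of_ne fun h' => hi.1 (eq_sub_of_add_eq h')]
  rw [hcongr] at key
  linarith
end

section
/- Let m ≥ 1 and let B be the inverse of the type-A Cartan matrix A_m. Then for every μ ∈ ℝ^m and every s ∈ {1,…,m}: ∑_{t=1}^{m} B_{st}·(μ_t + μ_{m+1−t}) = ∑_{q=0}^{s−1} ( ∑_{k=1}^{m−q} μ_k − ∑_{k=1}^{q} μ_k ), where empty sums are 0. -/
open Finset Matrix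

/-- The type-A Cartan matrix `A_m`: the 1-based entry `(i,j)` (stored at the 0-based
position `(i-1, j-1)`) is `2` if `i = j`, `-1` if `|i - j| = 1`, and `0` otherwise. -/
noncomputable def cartanA (m : ℕ) : Matrix (Fin m) (Fin m) ℝ := fun i j =>
  if i = j then 2 else if (i : ℕ) + 1 = (j : ℕ) ∨ (j : ℕ) + 1 = (i : ℕ) then -1 else 0

/-- The Cartan matrix of type `A` acts as the negative discrete Laplacian on sequences vanishing
at both ends. -/
theorem cartanA_mulVec_apply (m : ℕ) (F : ℕ → ℝ) (h0 : F 0 = 0) (h1 : F (m + 1) = 0)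
    (i : Fin m) :
    (cartanA m *ᵥ fun j => F ((j : ℕ) + 1)) i = 2 * F (i + 1) - F i - F (i + 2) := by
  have hentry : ∀ j : Fin m, cartanA m i j * F ((j : ℕ) + 1) =
      (if (i : ℕ) = j then 2 * F ((j : ℕ) + 1) else 0)
        - (if (i : ℕ) + 1 = j then F ((j : ℕ) + 1) else 0)
        - (if (i : ℕ) = j + 1 then F ((j : ℕ) + 1) else 0) := by
    intro j
    simp only [cartanA, Fin.ext_iff]
    split_ifs <;> first | omega | ring
  have hi := i.isLt
  have hdiag : ∑ j : Fin m, (if (i : ℕ) = j then 2 * F ((j : ℕ) + 1) else 0)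
      = 2 * F (i + 1) := by
    rw [Fin.sum_univ_eq_sum_range (fun j => if (i : ℕ) = j then 2 * F (j + 1) else 0) m,
      Finset.sum_ite_eq, if_pos (Finset.mem_range.2 hi)]
  have hsup : ∑ j : Fin m, (if (i : ℕ) + 1 = j then F ((j : ℕ) + 1) else 0)
      = F (i + 2) := by
    rw [Fin.sum_univ_eq_sum_range (fun j => if (i : ℕ) + 1 = j then F (j + 1) else 0) m,
      Finset.sum_ite_eq]
    split_ifs with h
    · rfl
    · have : (i : ℕ) + 2 = m + 1 := by
        rw [Finset.mem_range] at h
        omega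
      rw [this, h1]
  have hsub : ∑ j : Fin m, (if (i : ℕ) = j + 1 then F ((j : ℕ) + 1) else 0) = F i := by
    rw [Fin.sum_univ_eq_sum_range (fun j => if (i : ℕ) = j + 1 then F (j + 1) else 0) m]
    obtain hz | ⟨k, hk⟩ : (i : ℕ) = 0 ∨ ∃ k, (i : ℕ) = k + 1 := by
      cases (i : ℕ) <;> simp
    · simp [hz, h0]
    · simp only [hk, Nat.add_right_cancel_iff]
      rw [Finset.sum_ite_eq, if_pos (Finset.mem_range.2 (by omega))]
  simp only [Matrix.mulVec, dotProduct, hentry, Finset.sum_sub_distrib, hdiag, hsup, hsub]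
  ring

/-- If `B` is the inverse of `A_m`, then for every `μ ∈ ℝ^m` and `s ∈ {1,…,m}`
(`s` is the 1-based index `s.val + 1`):
`∑_{t=1}^m B_{st}(μ_t + μ_{m+1-t}) = ∑_{q=0}^{s-1}(∑_{k=1}^{m-q} μ_k - ∑_{k=1}^{q} μ_k)`. -/
theorem invCartanA_row_sum (m : ℕ) (hm : 1 ≤ m) (B : Matrix (Fin m) (Fin m) ℝ)
    (hB1 : cartanA m * B = 1) (hB2 : B * cartanA m = 1) (μ : ℕ → ℝ) (s : Fin m) :
    ∑ t : Fin m, B s t * (μ ((t : ℕ) + 1) + μ (m - (t : ℕ))) =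
      ∑ q ∈ Finset.range ((s : ℕ) + 1),
        (∑ k ∈ Finset.Icc 1 (m - q), μ k - ∑ k ∈ Finset.Icc 1 q, μ k) := by
  let S : ℕ → ℝ := fun n => ∑ k ∈ Finset.Icc 1 n, μ k
  let F : ℕ → ℝ := fun n => ∑ q ∈ Finset.range n, (S (m - q) - S q)
  have hS : ∀ n, S (n + 1) = S n + μ (n + 1) := fun n =>
    Finset.sum_Icc_succ_top (Nat.le_add_left 1 n) μ
  have hF : ∀ n, F (n + 1) = F n + (S (m - n) - S n) := fun n => Finset.sum_range_succ _ n
  have hF0 : F 0 = 0 := Finset.sum_range_zero _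
  have hFm : F (m + 1) = 0 := by
    have h := Finset.sum_range_reflect S (m + 1)
    simp only [Nat.add_sub_cancel] at h
    simp only [F, Finset.sum_sub_distrib, h, sub_self]
  have hA : (cartanA m *ᵥ fun j => F ((j : ℕ) + 1)) =
      fun t : Fin m => μ ((t : ℕ) + 1) + μ (m - (t : ℕ)) := by
    funext t
    rw [cartanA_mulVec_apply m F hF0 hFm]
    obtain ⟨r, hr⟩ : ∃ r, m - (t : ℕ) = r + 1 := ⟨m - t - 1, by omega⟩
    have hr' : m - ((t : ℕ) + 1) = r := by omega
    have e₁ := hF t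
    have e₂ := hF (t + 1)
    rw [hr, hS] at e₁
    rw [hr', hS] at e₂
    rw [hr]
    linarith
  calc ∑ t : Fin m, B s t * (μ ((t : ℕ) + 1) + μ (m - (t : ℕ)))
      = (B *ᵥ (cartanA m *ᵥ fun j => F ((j : ℕ) + 1))) s := by rw [hA]; rfl
    _ = F (s + 1) := by rw [Matrix.mulVec_mulVec, hB2, Matrix.one_mulVec]
end

section
/- Let n ≥ 2, μ, σ ∈ ℝ^{n+1}, and let j ∈ I and 2 ≤ l ≤ n−1 with j + l ≤ n+1; set J = {j, j+1, …, j+l}. Let W = ℜ_{j+1}ℜ_{j+2}⋯ℜ_{j+l−1}ℜ_{j+l}ℜ_{j+l−2}ℜ_{j+l−3}⋯ℜ_{j+1}ℜ_j (composition, rightmost applied first: ascending indices j+1,…,j+l then descending j+l−2,…,j+1,j). Then, with all σ-indices read cyclically modulo n+1: (W²σ)_s = σ_s for s ∈ I∖J; (W²σ)_j = 2∑_{k=j}^{j+l} μ_k + σ_{j−1} − σ_{j+l} + σ_{j+l+1}; (W²σ)_s = 2∑_{k=j+1}^{j+l−1} μ_k + 2∑_{k=j}^{j+l} μ_k + σ_{j−1}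 − σ_{j+1} − σ_{j+l−1} + σ_{j+l+1} + σ_s for j+1 ≤ s ≤ j+l−1; and (W²σ)_{j+l} = 2∑_{k=j}^{j+l} μ_k + σ_{j−1} − σ_j + σ_{j+l+1}. -/
open Finset

/-- The affine reflection `ℜ_i` associated to `μ`. -/
noncomputable def reflA (n : ℕ) (μ : ZMod (n + 1) → ℝ) (i : ZMod (n + 1))
    (σ : ZMod (n + 1) → ℝ) : ZMod (n + 1) → ℝ :=
  Function.update σ i (2 * μ i - ∑ t : ZMod (n + 1), affA n i t * σ t + σ i)

/-- `ℜ_i` for a 1-based natural index `i` (read cyclically). -/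
noncomputable def reflAN (n : ℕ) (μ : ZMod (n + 1) → ℝ) (i : ℕ) :
    (ZMod (n + 1) → ℝ) → (ZMod (n + 1) → ℝ) :=
  reflA n μ (i : ZMod (n + 1))

/-- `upChain R a k` applies `R a, R (a+1), …, R (a+k-1)` in this order
(i.e. `R a` first). -/
def upChain {α : Type*} (R : ℕ → α → α) : ℕ → ℕ → α → α
  | _, 0, σ => σ
  | a, k + 1, σ => upChain R (a + 1) k (R a σ)

/-- `downChain R b k` applies `R b, R (b-1), …, R (b-k+1)` in this order
(i.e. `R b` first). -/
def downChain {α : Type*} (R : ℕ → α → α) : ℕ → ℕ → α → α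
  | _, 0, σ => σ
  | b, k + 1, σ => downChain R (b - 1) k (R b σ)

/-- The composition `W = ℜ_{j+1}⋯ℜ_{j+l-1}ℜ_{j+l}ℜ_{j+l-2}⋯ℜ_{j+1}ℜ_j`
(rightmost applied first): first `ℜ_j, ℜ_{j+1}, …, ℜ_{j+l-2}` (ascending),
then `ℜ_{j+l}`, then `ℜ_{j+l-1}, …, ℜ_{j+1}` (descending). -/
noncomputable def Wchain (n : ℕ) (μ : ZMod (n + 1) → ℝ) (j l : ℕ)
    (σ : ZMod (n + 1) → ℝ) : ZMod (n + 1) → ℝ :=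
  downChain (reflAN n μ) (j + l - 1) (l - 1)
    (reflAN n μ (j + l) (upChain (reflAN n μ) j (l - 1) σ))

/-- Natural numbers less than `n + 1` apart have distinct residues. -/
lemma natCast_ne_of_lt {n x y : ℕ} (h : x < y) (h' : y < x + (n + 1)) :
    (x : ZMod (n + 1)) ≠ y := by
  intro e
  rw [ZMod.natCast_eq_natCast_iff, Nat.modEq_iff_dvd' h.le] at e
  have := Nat.le_of_dvd (by omega) e
  omega

lemma reflAN_apply_of_ne {n i : ℕ} {x : ZMod (n + 1)} (μ σ : ZMod (n + 1) → ℝ) (h : x ≠ i) :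
    reflAN n μ i σ x = σ x := by
  simp [reflAN, reflA, Function.update_of_ne h]

lemma reflAN_apply_self {n : ℕ} (hn : 2 ≤ n) (μ σ : ZMod (n + 1) → ℝ) (i : ℕ) :
    reflAN n μ (i + 1) σ ((i + 1 : ℕ) : ZMod (n + 1)) =
      2 * μ ((i + 1 : ℕ) : ZMod (n + 1)) + σ (i : ZMod (n + 1))
        + σ ((i + 2 : ℕ) : ZMod (n + 1)) - σ ((i + 1 : ℕ) : ZMod (n + 1)) := by
  have h01 : (i : ZMod (n + 1)) ≠ (i + 1 : ℕ) := natCast_ne_of_lt (by omega) (by omega)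
  have h02 : (i : ZMod (n + 1)) ≠ (i + 2 : ℕ) := natCast_ne_of_lt (by omega) (by omega)
  have h12 : ((i + 1 : ℕ) : ZMod (n + 1)) ≠ (i + 2 : ℕ) :=
    natCast_ne_of_lt (by omega) (by omega)
  have hsum : ∑ t : ZMod (n + 1), affA n ((i + 1 : ℕ) : ZMod (n + 1)) t * σ t =
      2 * σ ((i + 1 : ℕ) : ZMod (n + 1)) - σ (i : ZMod (n + 1))
        - σ ((i + 2 : ℕ) : ZMod (n + 1)) := by
    have hterm : ∀ t : ZMod (n + 1), affA n ((i + 1 : ℕ) : ZMod (n + 1)) t * σ t =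
        (if t = ((i + 1 : ℕ) : ZMod (n + 1)) then 2 * σ t else 0)
          - (if t = (i : ZMod (n + 1)) then σ t else 0)
          - (if t = ((i + 2 : ℕ) : ZMod (n + 1)) then σ t else 0) := by
      intro t
      have hpred : ((i + 1 : ℕ) : ZMod (n + 1)) = t + 1 ↔ t = i := by
        push_cast
        rw [add_left_inj, eq_comm]
      have hsucc : t = ((i + 1 : ℕ) : ZMod (n + 1)) + 1 ↔ t = ((i + 2 : ℕ) : ZMod (n + 1)) := by
        push_cast
        rw [add_assoc, one_add_one_eq_two]
      unfold affA
      simp only [hpred, hsucc, eq_comm (b := t)]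
      by_cases h1 : t = ((i + 1 : ℕ) : ZMod (n + 1))
      · rw [if_pos h1, if_pos h1, if_neg (h1 ▸ h01.symm), if_neg (h1 ▸ h12)]
        ring
      · by_cases h0 : t = (i : ZMod (n + 1))
        · rw [if_neg h1, if_neg h1, if_pos (Or.inl h0), if_pos h0, if_neg (h0 ▸ h02)]
          ring
        · rw [if_neg h1, if_neg h1, if_neg h0]
          by_cases h2 : t = ((i + 2 : ℕ) : ZMod (n + 1))
          · rw [if_pos (Or.inr h2), if_pos h2]
            ring
          · rw [if_neg (not_or.mpr ⟨h0, h2⟩), if_neg h2]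
            ring
    simp only [hterm, Finset.sum_sub_distrib, Finset.sum_ite_eq', Finset.mem_univ, if_true]
  simp only [reflAN, reflA, Function.update_self, hsum]
  ring

lemma upChain_reflAN_apply_of_ne {n : ℕ} (μ : ZMod (n + 1) → ℝ) {k a : ℕ}
    (σ : ZMod (n + 1) → ℝ) {x : ZMod (n + 1)} (h : ∀ y, a ≤ y → y < a + k → x ≠ (y : ℕ)) :
    upChain (reflAN n μ) a k σ x = σ x := by
  induction k generalizing a σ with
  | zero => rfl
  | succ k ih =>
    rw [upChain, ih _ fun y h1 h2 => h y (by omega) (by omega),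
      reflAN_apply_of_ne _ _ (h a le_rfl (by omega))]

lemma downChain_reflAN_apply_of_ne {n : ℕ} (μ : ZMod (n + 1) → ℝ) {k a : ℕ}
    (σ : ZMod (n + 1) → ℝ) {x : ZMod (n + 1)} (h : ∀ y, a < y → y ≤ a + k → x ≠ (y : ℕ)) :
    downChain (reflAN n μ) (a + k) k σ x = σ x := by
  induction k generalizing σ with
  | zero => rfl
  | succ k ih =>
    rw [downChain, ← add_assoc, Nat.add_sub_cancel,
      ih _ fun y h1 h2 => h y h1 (by omega),
      reflAN_apply_of_ne _ _ (h _ (by omega) (by omega))]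

lemma upChain_reflAN_apply {n : ℕ} (hn : 2 ≤ n) (μ : ZMod (n + 1) → ℝ) {k a m : ℕ}
    (σ : ZMod (n + 1) → ℝ) (hk : k < n) (hm : m < k) :
    upChain (reflAN n μ) (a + 1) k σ ((a + 1 + m : ℕ) : ZMod (n + 1)) =
      2 * ∑ i ∈ Finset.Ico (a + 1) (a + m + 2), μ (i : ZMod (n + 1)) + σ (a : ZMod (n + 1))
        + σ ((a + m + 2 : ℕ) : ZMod (n + 1)) - σ ((a + 1 : ℕ) : ZMod (n + 1)) := by
  induction k generalizing a m σ with
  | zero => omega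
  | succ k ih =>
    rw [upChain]
    cases m with
    | zero =>
      rw [upChain_reflAN_apply_of_ne, add_zero, reflAN_apply_self hn]
      · simp
      · exact fun y h1 h2 => natCast_ne_of_lt (by omega) (by omega)
    | succ m =>
      rw [show a + 1 + (m + 1) = a + 1 + 1 + m by ring, ih _ (by omega) (by omega),
        reflAN_apply_self hn,
        reflAN_apply_of_ne _ _ (natCast_ne_of_lt (x := a + 1) (by omega) (by omega)).symm,
        reflAN_apply_of_ne _ _ (natCast_ne_of_lt (x := a + 1) (by omega) (by omega)).symm,
        Finset.sum_eq_sum_Ico_succ_bot (a := a + 1) (by omega),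
        show a + 1 + m + 2 = a + (m + 1) + 2 by ring]
      ring

lemma downChain_reflAN_apply {n : ℕ} (hn : 2 ≤ n) (μ : ZMod (n + 1) → ℝ) {k a m : ℕ}
    (σ : ZMod (n + 1) → ℝ) (hk : k < n) (hm : m < k) :
    downChain (reflAN n μ) (a + k) k σ ((a + m + 1 : ℕ) : ZMod (n + 1)) =
      2 * ∑ i ∈ Finset.Ico (a + m + 1) (a + k + 1), μ (i : ZMod (n + 1))
        + σ ((a + m : ℕ) : ZMod (n + 1))
        + σ ((a + k + 1 : ℕ) : ZMod (n + 1)) - σ ((a + k : ℕ) : ZMod (n + 1)) := by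
  induction k generalizing m σ with
  | zero => omega
  | succ k ih =>
    rw [downChain, ← add_assoc, Nat.add_sub_cancel]
    rcases Nat.lt_succ_iff_lt_or_eq.mp hm with hm | rfl
    · rw [ih _ (by omega) hm, reflAN_apply_self hn,
        reflAN_apply_of_ne _ _ (natCast_ne_of_lt (y := a + k + 1) (by omega) (by omega)),
        reflAN_apply_of_ne _ _ (natCast_ne_of_lt (y := a + k + 1) (by omega) (by omega)),
        Finset.sum_Ico_succ_top (b := a + k + 1) (by omega)]
      ring
    · rw [downChain_reflAN_apply_of_ne, reflAN_apply_self hn]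
      · rw [Nat.Ico_succ_singleton, Finset.sum_singleton]
      · exact fun y h1 h2 => (natCast_ne_of_lt (by omega) (by omega)).symm

section Wchain

variable {n a p : ℕ} (μ σ : ZMod (n + 1) → ℝ)

lemma Wchain_eq : Wchain n μ (a + 1) (p + 2) σ =
    downChain (reflAN n μ) (a + 1 + (p + 1)) (p + 1)
      (reflAN n μ (a + p + 3) (upChain (reflAN n μ) (a + 1) (p + 1) σ)) := by
  rw [Wchain, show a + 1 + (p + 2) - 1 = a + 1 + (p + 1) by omega,
    show p + 2 - 1 = p + 1 by omega, show a + 1 + (p + 2) = a + p + 3 by ring]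

lemma Wchain_apply_of_ne {x : ZMod (n + 1)}
    (h : ∀ y, a + 1 ≤ y → y ≤ a + p + 3 → x ≠ (y : ℕ)) :
    Wchain n μ (a + 1) (p + 2) σ x = σ x := by
  rw [Wchain_eq, downChain_reflAN_apply_of_ne, reflAN_apply_of_ne, upChain_reflAN_apply_of_ne]
  · exact fun y h1 h2 => h y (by omega) (by omega)
  · exact h _ (by omega) (by omega)
  · exact fun y h1 h2 => h y (by omega) (by omega)

lemma Wchain_apply_first (hp : p + 3 ≤ n) :
    Wchain n μ (a + 1) (p + 2) σ ((a + 1 : ℕ) : ZMod (n + 1)) =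
      2 * μ ((a + 1 : ℕ) : ZMod (n + 1)) + σ (a : ZMod (n + 1))
        + σ ((a + 2 : ℕ) : ZMod (n + 1)) - σ ((a + 1 : ℕ) : ZMod (n + 1)) := by
  rw [Wchain_eq, downChain_reflAN_apply_of_ne, reflAN_apply_of_ne]
  · simpa using upChain_reflAN_apply (by omega) μ (a := a) (m := 0) σ
      (by omega : p + 1 < n) (by omega)
  · exact natCast_ne_of_lt (by omega) (by omega)
  · exact fun y h1 h2 => natCast_ne_of_lt (by omega) (by omega)

lemma Wchain_apply_last (hp : p + 3 ≤ n) :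
    Wchain n μ (a + 1) (p + 2) σ ((a + p + 3 : ℕ) : ZMod (n + 1)) =
      2 * μ ((a + p + 3 : ℕ) : ZMod (n + 1)) + σ ((a + p + 2 : ℕ) : ZMod (n + 1))
        + σ ((a + p + 4 : ℕ) : ZMod (n + 1)) - σ ((a + p + 3 : ℕ) : ZMod (n + 1)) := by
  rw [Wchain_eq, downChain_reflAN_apply_of_ne, reflAN_apply_self (by omega),
    upChain_reflAN_apply_of_ne, upChain_reflAN_apply_of_ne, upChain_reflAN_apply_of_ne]
  all_goals exact fun y h1 h2 => (natCast_ne_of_lt (by omega) (by omega)).symm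

lemma Wchain_apply_middle (hp : p + 3 ≤ n) {m : ℕ} (hm : m ≤ p) :
    Wchain n μ (a + 1) (p + 2) σ ((a + 2 + m : ℕ) : ZMod (n + 1)) =
      2 * ∑ i ∈ Finset.Ico (a + 1) (a + p + 4), μ (i : ZMod (n + 1)) + σ (a : ZMod (n + 1))
        - σ ((a + 1 : ℕ) : ZMod (n + 1)) - σ ((a + p + 3 : ℕ) : ZMod (n + 1))
        + σ ((a + p + 4 : ℕ) : ZMod (n + 1)) + σ ((a + 2 + m : ℕ) : ZMod (n + 1)) := by
  rw [Wchain_eq, show a + 2 + m = a + 1 + m + 1 by ring,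
    downChain_reflAN_apply (by omega) μ _ (by omega) (by omega),
    show a + 1 + (p + 1) + 1 = a + p + 2 + 1 by ring, reflAN_apply_self (by omega),
    reflAN_apply_of_ne _ _ (natCast_ne_of_lt (y := a + p + 3) (by omega) (by omega)),
    reflAN_apply_of_ne _ _ (natCast_ne_of_lt (y := a + p + 3) (by omega) (by omega)),
    upChain_reflAN_apply (by omega) μ σ (by omega) (by omega),
    upChain_reflAN_apply_of_ne (x := ((a + p + 2 + 1 : ℕ) : ZMod (n + 1))),
    upChain_reflAN_apply_of_ne (x := ((a + p + 2 + 2 : ℕ) : ZMod (n + 1))),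
    Finset.sum_Ico_succ_top (b := a + p + 3) (by omega),
    ← Finset.sum_Ico_consecutive _ (m := a + 1) (n := a + m + 2) (k := a + p + 3)
      (by omega) (by omega),
    show a + 1 + (p + 1) = a + p + 2 by ring, show a + 1 + m + 1 = a + m + 2 by ring]
  · ring
  all_goals exact fun y h1 h2 => (natCast_ne_of_lt (by omega) (by omega)).symm

end Wchain

/-- The explicit formula for `W² σ` where `W` is the `J`-chain word on
`J = {j, …, j+l}`, all `σ`-indices being read cyclically mod `n+1`. -/
theorem Wchain_sq_formula (n : ℕ) (hn : 2 ≤ n) (μ σ : ZMod (n + 1) → ℝ)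
    (j l : ℕ) (hj : 1 ≤ j) (hj2 : j ≤ n + 1) (hl2 : 2 ≤ l) (hln : l ≤ n - 1) (hjl : j + l ≤ n + 1) :
    (∀ s ∈ Finset.Icc 1 (n + 1), s ∉ Finset.Icc j (j + l) →
      Wchain n μ j l (Wchain n μ j l σ) (s : ZMod (n + 1)) = σ (s : ZMod (n + 1))) ∧
    (Wchain n μ j l (Wchain n μ j l σ) (j : ZMod (n + 1)) =
      2 * ∑ k ∈ Finset.Icc j (j + l), μ (k : ZMod (n + 1))
        + σ ((j : ZMod (n + 1)) - 1) - σ ((j + l : ℕ) : ZMod (n + 1))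
        + σ ((j + l + 1 : ℕ) : ZMod (n + 1))) ∧
    (∀ s : ℕ, j + 1 ≤ s → s ≤ j + l - 1 →
      Wchain n μ j l (Wchain n μ j l σ) (s : ZMod (n + 1)) =
        2 * ∑ k ∈ Finset.Icc (j + 1) (j + l - 1), μ (k : ZMod (n + 1))
          + 2 * ∑ k ∈ Finset.Icc j (j + l), μ (k : ZMod (n + 1))
          + σ ((j : ZMod (n + 1)) - 1) - σ ((j + 1 : ℕ) : ZMod (n + 1))
          - σ ((j + l - 1 : ℕ) : ZMod (n + 1)) + σ ((j + l + 1 : ℕ) : ZMod (n + 1))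
          + σ (s : ZMod (n + 1))) ∧
    (Wchain n μ j l (Wchain n μ j l σ) ((j + l : ℕ) : ZMod (n + 1)) =
      2 * ∑ k ∈ Finset.Icc j (j + l), μ (k : ZMod (n + 1))
        + σ ((j : ZMod (n + 1)) - 1) - σ (j : ZMod (n + 1))
        + σ ((j + l + 1 : ℕ) : ZMod (n + 1))) := by
  obtain ⟨a, rfl⟩ := Nat.exists_eq_add_of_le' hj
  obtain ⟨p, rfl⟩ := Nat.exists_eq_add_of_le' hl2
  have hp : p + 3 ≤ n := by omega
  have ha : Wchain n μ (a + 1) (p + 2) σ (a : ZMod (n + 1)) = σ a :=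
    Wchain_apply_of_ne μ σ fun y h1 h2 => natCast_ne_of_lt (by omega) (by omega)
  have hb : Wchain n μ (a + 1) (p + 2) σ ((a + p + 4 : ℕ) : ZMod (n + 1)) =
      σ ((a + p + 4 : ℕ) : ZMod (n + 1)) :=
    Wchain_apply_of_ne μ σ fun y h1 h2 => (natCast_ne_of_lt (by omega) (by omega)).symm
  have h_second := Wchain_apply_middle (a := a) μ σ hp (Nat.zero_le p)
  have h_penult := Wchain_apply_middle (a := a) μ σ hp (le_refl p)
  rw [add_zero] at h_second
  rw [show a + 2 + p = a + p + 2 by ring] at h_penult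
  have hcast : ((a + 1 : ℕ) : ZMod (n + 1)) - 1 = a := by push_cast; ring
  have hJ : Finset.Icc (a + 1) (a + p + 3) = Finset.Ico (a + 1) (a + p + 4) := by
    ext; simp only [Finset.mem_Icc, Finset.mem_Ico]; omega
  have hJ' : Finset.Icc (a + 2) (a + p + 2) = Finset.Ico (a + 2) (a + p + 3) := by
    ext; simp only [Finset.mem_Icc, Finset.mem_Ico]; omega
  have hsum : ∑ k ∈ Finset.Ico (a + 1) (a + p + 4), μ (k : ZMod (n + 1)) =
      μ ((a + 1 : ℕ) : ZMod (n + 1)) +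
        ∑ k ∈ Finset.Ico (a + 2) (a + p + 3), μ (k : ZMod (n + 1)) +
        μ ((a + p + 3 : ℕ) : ZMod (n + 1)) := by
    rw [Finset.sum_Ico_succ_top (by omega), Finset.sum_eq_sum_Ico_succ_bot (by omega)]
  rw [hcast, show a + 1 + (p + 2) = a + p + 3 by ring, hJ,
    show a + p + 3 - 1 = a + p + 2 by omega, hJ']
  refine ⟨fun s hs hsJ => ?_, ?_, fun s hs1 hs2 => ?_, ?_⟩
  · have hne : ∀ y, a + 1 ≤ y → y ≤ a + p + 3 → (s : ZMod (n + 1)) ≠ (y : ℕ) := by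
      intro y h1 h2
      simp only [Finset.mem_Icc, Finset.mem_Ico] at hs hsJ
      rcases lt_or_ge s y with h | h
      · exact natCast_ne_of_lt h (by omega)
      · exact (natCast_ne_of_lt (by omega) (by omega)).symm
    rw [Wchain_apply_of_ne _ _ hne, Wchain_apply_of_ne _ _ hne]
  · rw [Wchain_apply_first _ _ hp, Wchain_apply_first _ _ hp, ha, h_second]
    ring
  · obtain ⟨m, rfl⟩ := Nat.exists_eq_add_of_le hs1
    have hm : m ≤ p := by omega
    rw [show a + 1 + 1 + m = a + 2 + m by ring, Wchain_apply_middle _ _ hp hm,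
      Wchain_apply_middle _ _ hp hm, ha, hb, Wchain_apply_first _ _ hp,
      Wchain_apply_last _ _ hp, hsum]
    ring_nf
  · rw [Wchain_apply_last _ _ hp, Wchain_apply_last _ _ hp, hb, h_penult]
    ring_nf
end

section
/- Let n ≥ 2, μ ∈ ℝ^{n+1}, and σ ∈ Γ_A(μ). Set μ*_s = μ_s − (1/2)∑_{t∈I} K_{st} σ_t for s ∈ I. Let J = {j, j+1, …, j+l} with j ∈ I, l ≥ 0, j + l ≤ n+1, and J ≠ I, and let (k^{st})_{s,t∈J} be the inverse of the submatrix (K_{st})_{s,t∈J} (which equals the type-A Cartan matrix A_{l+1}). Define σ*_s = σ_s for s ∈ I∖J and σ*_s = σ_s + 2∑_{t∈J} k^{st}(μ*_t + μ*_{t*}) for s ∈ J, where t* = 2j + l − t. Then σ* ∈ Γ_A(μ). -/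
open Finset

/-- `Γ_A(μ)`: the smallest subset of `ℝ^{n+1}` containing `0` and closed under all `ℜ_i`. -/
inductive GammaA (n : ℕ) (μ : ZMod (n + 1) → ℝ) : (ZMod (n + 1) → ℝ) → Prop
  | zero : GammaA n μ 0
  | refl (i : ZMod (n + 1)) (σ : ZMod (n + 1) → ℝ) :
      GammaA n μ σ → GammaA n μ (reflA n μ i σ)

/-- The vector `μ*` attached to `σ`: `μ_s - ½ ∑_t K_{st} σ_t`. -/
noncomputable def weightA (n : ℕ) (μ σ : ZMod (n + 1) → ℝ) (z : ZMod (n + 1)) : ℝ :=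
  μ z - (1 / 2) * ∑ t : ZMod (n + 1), affA n z t * σ t

lemma weightA_reflA (n : ℕ) (μ σ : ZMod (n + 1) → ℝ) (i z : ZMod (n + 1)) :
    weightA n μ (reflA n μ i σ) z = weightA n μ σ z - affA n z i * weightA n μ σ i := by
  have h : reflA n μ i σ = fun t => σ t + if t = i then 2 * weightA n μ σ i else 0 := by
    funext t
    by_cases ht : t = i
    · subst ht
      simp only [reflA, Function.update_self, weightA, if_true]
      ring
    · simp [reflA, ht]
  have hs : ∑ t, affA n z t * reflA n μ i σ t =
      ∑ t, affA n z t * σ t + affA n z i * (2 * weightA n μ σ i) := by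
    simp [h, mul_add, Finset.sum_add_distrib]
  rw [weightA, hs]
  simp only [weightA]
  ring

lemma natCast_zmod_inj {n a b : ℕ} (ha : a ≤ n) (hb : b ≤ n) :
    (a : ZMod (n + 1)) = b ↔ a = b := by
  rw [ZMod.natCast_eq_natCast_iff, Nat.ModEq, Nat.mod_eq_of_lt (by lia),
    Nat.mod_eq_of_lt (by lia)]

lemma affA_natCast {n j l a b : ℕ} (hl : l < n) (ha : a ≤ l) (hb : b ≤ l) :
    affA n ((j + a : ℕ) : ZMod (n + 1)) ((j + b : ℕ) : ZMod (n + 1)) =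
      if a = b then 2 else if a = b + 1 ∨ b = a + 1 then -1 else 0 := by
  have h (c d : ℕ) (hc : c ≤ n) (hd : d ≤ n) :
      (j : ZMod (n + 1)) + (c : ZMod (n + 1)) = j + (d : ZMod (n + 1)) ↔ c = d := by
    rw [add_right_inj, natCast_zmod_inj hc hd]
  have h₁ := h a b (by lia) (by lia)
  have h₂ := h a (b + 1) (by lia) (by lia)
  have h₃ := h b (a + 1) (by lia) (by lia)
  push_cast at h₁ h₂ h₃
  simp only [affA, Nat.cast_add, add_assoc, h₁, h₂, h₃]

/-- Reflections in a chain `j, …, j + l` realise every permutation of the coordinates `x` for which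
`μ*_{j+i} = x_i - x_{i+1}`. -/
lemma GammaA.exists_perm {n : ℕ} {μ σ : ZMod (n + 1) → ℝ} (hσ : GammaA n μ σ) {j l : ℕ}
    (hl : l < n) (x : Fin (l + 2) → ℝ)
    (hx : ∀ i : Fin (l + 1), weightA n μ σ ((j + i : ℕ) : ZMod (n + 1)) = x i.castSucc - x i.succ)
    (π : Equiv.Perm (Fin (l + 2))) :
    ∃ τ, GammaA n μ τ ∧
      (∀ z, (∀ i : Fin (l + 1), z ≠ ((j + i : ℕ) : ZMod (n + 1))) → τ z = σ z) ∧
      ∀ i : Fin (l + 1), weightA n μ τ ((j + i : ℕ) : ZMod (n + 1)) =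
        x (π i.castSucc) - x (π i.succ) := by
  have hπ : π ∈ Submonoid.closure
      (Set.range fun i : Fin (l + 1) => Equiv.swap i.castSucc i.succ) := by
    rw [Equiv.Perm.mclosure_swap_castSucc_succ]
    trivial
  induction hπ using Submonoid.closure_induction_right with
  | one => exact ⟨σ, hσ, fun _ _ => rfl, hx⟩
  | mul_right π _ s hs ih =>
    obtain ⟨i, rfl⟩ := hs
    obtain ⟨τ, hτ, hoff, hw⟩ := ih
    refine ⟨reflA n μ ((j + i : ℕ) : ZMod (n + 1)) τ, hτ.refl _ _, fun z hz => ?_, fun k => ?_⟩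
    · rw [← hoff z hz, reflA, Function.update_of_ne (hz i)]
    · rw [weightA_reflA, hw, hw, affA_natCast hl (Nat.lt_succ_iff.1 k.2) (Nat.lt_succ_iff.1 i.2)]
      simp only [Equiv.Perm.mul_apply]
      by_cases h₁ : (k : ℕ) = i
      · obtain rfl := Fin.ext h₁
        simp
        ring
      by_cases h₂ : (k : ℕ) = i + 1
      · have e : k.castSucc = i.succ := Fin.ext (by simp [h₂])
        rw [Equiv.swap_apply_of_ne_of_ne (x := k.succ), e, Equiv.swap_apply_right]
        · simp [h₂]
        · simp [Fin.ext_iff]; lia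
        · simp [Fin.ext_iff]; lia
      by_cases h₃ : (i : ℕ) = k + 1
      · have e : k.succ = i.castSucc := Fin.ext (by simp [h₃])
        rw [Equiv.swap_apply_of_ne_of_ne (x := k.castSucc), e, Equiv.swap_apply_left]
        · simp [h₃]
        · simp [Fin.ext_iff]; lia
        · simp [Fin.ext_iff]; lia
      rw [Equiv.swap_apply_of_ne_of_ne, Equiv.swap_apply_of_ne_of_ne]
      · simp [h₁, h₂, h₃]
      all_goals simp [Fin.ext_iff]; lia

/-- The longest element of the Weyl group of the chain `j, …, j + l`. -/
lemma GammaA.exists_reverse {n : ℕ} {μ σ : ZMod (n + 1) → ℝ} (hσ : GammaA n μ σ) {j l : ℕ}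
    (hl : l < n) :
    ∃ τ, GammaA n μ τ ∧
      (∀ z, (∀ s ∈ Icc j (j + l), z ≠ (s : ZMod (n + 1))) → τ z = σ z) ∧
      ∀ s ∈ Icc j (j + l), weightA n μ τ (s : ZMod (n + 1)) =
        - weightA n μ σ ((2 * j + l - s : ℕ) : ZMod (n + 1)) := by
  set m : ℕ → ℝ := fun k => weightA n μ σ ((j + k : ℕ) : ZMod (n + 1)) with hm
  have hx (i : Fin (l + 1)) : m i =
      -∑ k ∈ range (i.castSucc : Fin (l + 2)), m k - -∑ k ∈ range (i.succ : Fin (l + 2)), m k := by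
    simp [sum_range_succ]
  obtain ⟨τ, hτ, hoff, hw⟩ := hσ.exists_perm (j := j) hl
    (fun i : Fin (l + 2) => -∑ k ∈ range i, m k) hx Fin.revPerm
  refine ⟨τ, hτ, fun z hz => hoff z fun i => hz _ (mem_Icc.2 (by lia)), fun s hs => ?_⟩
  rw [mem_Icc] at hs
  have hi := hw ⟨s - j, by lia⟩
  have hr := hx (Fin.rev ⟨s - j, by lia⟩)
  simp only [Fin.revPerm_apply, Fin.rev_castSucc, Fin.rev_succ] at hi
  rw [show j + (s - j) = s by lia] at hi
  rw [hi, show 2 * j + l - s = j + (Fin.rev (⟨s - j, by lia⟩ : Fin (l + 1)) : ℕ) by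
    simp only [Fin.val_rev]; lia]
  change _ = -m _
  rw [hr]
  ring

/-- If `σ ∈ Γ_A(μ)`, `μ*_s = μ_s - ½∑_t K_{st}σ_t`, `J = {j,…,j+l} ⊊ I` is a
consecutive-index set and `(k^{st})` is the inverse of the submatrix `(K_{st})_{s,t∈J}`,
then `σ*` with `σ*_s = σ_s` off `J` and
`σ*_s = σ_s + 2∑_{t∈J} k^{st}(μ*_t + μ*_{2j+l-t})` on `J` is again in `Γ_A(μ)`. -/
theorem gammaA_chain_step (n : ℕ) (hn : 2 ≤ n) (μ σ : ZMod (n + 1) → ℝ)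
    (hσ : GammaA n μ σ)
    (μstar : ℕ → ℝ)
    (hμstar : ∀ s : ℕ, μstar s =
      μ (s : ZMod (n + 1)) - (1 / 2) * ∑ t : ZMod (n + 1), affA n (s : ZMod (n + 1)) t * σ t)
    (j l : ℕ) (hj : 1 ≤ j) (hjl : j + l ≤ n + 1) (hJI : ¬(j = 1 ∧ j + l = n + 1))
    (kinv : ℕ → ℕ → ℝ)
    (hkinv1 : ∀ s ∈ Finset.Icc j (j + l), ∀ u ∈ Finset.Icc j (j + l),
      ∑ t ∈ Finset.Icc j (j + l),
        affA n (s : ZMod (n + 1)) (t : ZMod (n + 1)) * kinv t u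
        = if s = u then 1 else 0)
    (hkinv2 : ∀ s ∈ Finset.Icc j (j + l), ∀ u ∈ Finset.Icc j (j + l),
      ∑ t ∈ Finset.Icc j (j + l),
        kinv s t * affA n (t : ZMod (n + 1)) (u : ZMod (n + 1))
        = if s = u then 1 else 0)
    (σstar : ZMod (n + 1) → ℝ)
    (hσstar1 : ∀ s ∈ Finset.Icc 1 (n + 1), s ∉ Finset.Icc j (j + l) →
      σstar (s : ZMod (n + 1)) = σ (s : ZMod (n + 1)))
    (hσstar2 : ∀ s ∈ Finset.Icc j (j + l),
      σstar (s : ZMod (n + 1)) = σ (s : ZMod (n + 1)) +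
        2 * ∑ t ∈ Finset.Icc j (j + l), kinv s t * (μstar t + μstar (2 * j + l - t))) :
    GammaA n μ σstar := by
  have hl : l < n := by lia
  obtain ⟨τ, hτ, hoff, hw⟩ := hσ.exists_reverse (j := j) hl
  have hinj : Set.InjOn (fun s : ℕ => (s : ZMod (n + 1))) (Icc j (j + l)) := by
    intro a ha b hb hab
    simp only [coe_Icc, Set.mem_Icc] at ha hb
    obtain ⟨a, rfl⟩ := Nat.exists_eq_add_of_le ha.1
    obtain ⟨b, rfl⟩ := Nat.exists_eq_add_of_le hb.1
    simp only [Nat.cast_add, add_right_inj] at hab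
    rw [(natCast_zmod_inj (by lia) (by lia)).1 hab]
  have hdiff : ∀ s ∈ Icc j (j + l), ∑ u ∈ Icc j (j + l), affA n (s : ZMod (n + 1)) u *
      (τ u - σ u) = 2 * (μstar s + μstar (2 * j + l - s)) := by
    intro s hs
    have hsum : ∑ u ∈ Icc j (j + l), affA n (s : ZMod (n + 1)) u * (τ u - σ u) =
        ∑ z, affA n (s : ZMod (n + 1)) z * (τ z - σ z) := by
      rw [← sum_image (f := fun z => affA n (s : ZMod (n + 1)) z * (τ z - σ z)) hinj]
      refine sum_subset (subset_univ _) fun z _ hz => ?_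
      rw [hoff z fun u hu h => hz (mem_image.2 ⟨u, hu, h.symm⟩), sub_self, mul_zero]
    have h := hw s hs
    rw [weightA, weightA, ← hμstar] at h
    rw [hsum, hμstar s]
    simp only [mul_sub, sum_sub_distrib]
    linarith
  have hstar : σstar = τ := by
    funext z
    by_cases hz : ∃ s ∈ Icc j (j + l), z = (s : ZMod (n + 1))
    · obtain ⟨s, hs, rfl⟩ := hz
      have key : 2 * ∑ t ∈ Icc j (j + l), kinv s t * (μstar t + μstar (2 * j + l - t)) =
          τ s - σ s := by
        calc _ = ∑ t ∈ Icc j (j + l), ∑ u ∈ Icc j (j + l),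
              kinv s t * affA n (t : ZMod (n + 1)) u * (τ u - σ u) := by
              rw [mul_sum]
              refine sum_congr rfl fun t ht => ?_
              simp only [mul_assoc, ← mul_sum, hdiff t ht]
              ring
          _ = ∑ u ∈ Icc j (j + l), (if s = u then 1 else 0) * (τ u - σ u) := by
              rw [sum_comm]
              exact sum_congr rfl fun u hu => by rw [← sum_mul, hkinv2 s hs u hu]
          _ = _ := by simp only [ite_mul, one_mul, zero_mul, sum_ite_eq, if_pos hs]
      rw [hσstar2 s hs, key]
      ring
    · push Not at hz
      have hcast : (((z - 1).val + 1 : ℕ) : ZMod (n + 1)) = z := by simp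
      have hlt := ZMod.val_lt (z - 1)
      have h := hσstar1 ((z - 1).val + 1) (mem_Icc.2 (by lia)) fun hmem => hz _ hmem hcast.symm
      rw [hcast] at h
      rw [h, hoff z hz]
  exact hstar ▸ hτ
end

section
/- Let n ≥ 2, μ ∈ ℝ^{n+1}, σ ∈ Γ_A(μ), and set μ*_s = μ_s − (1/2)∑_{t∈I} K_{st} σ_t for s ∈ I. Suppose I = N ⊔ J_1 ⊔ … ⊔ J_ϑ (ϑ ≥ 1), where the J_p = {i_p, …, i_p + l_p} (with i_p + l_p ≤ n+1, so non-wrapping) are pairwise disjoint, N ≠ ∅, {1, n+1} ∩ N ≠ ∅, and for each p both cyclic neighbors i_p − 1 and i_p + l_p + 1 (taken mod n+1) belong to N. For each p let (k_p^{ij})_{i,j∈J_p} be the inverse of the submatrix (K_{ij})_{i,j∈J_p}. Define σ*_i = σ_i for i ∈ N and σ*_i = σ_i + 2∑_{j∈J_p} k_p^{ij}(μ*_j + μ*_{j_p*}) for i ∈ J_p, where j_p* = 2i_p + l_p − j. Then σ* ∈ Γ_A(μ). -/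
open Finset

/-- The set `N = I \ (J_1 ∪ ⋯ ∪ J_ϑ)`, where `J_p = {i_p, …, i_p + l_p}`. -/
def NsetA (n ϑ : ℕ) (ip lp : ℕ → ℕ) : Finset ℕ :=
  Finset.Icc 1 (n + 1) \
    (Finset.Icc 1 ϑ).biUnion (fun p => Finset.Icc (ip p) (ip p + lp p))

/-- The vector `μ* = μ - K σ / 2`. -/
noncomputable def dualA (n : ℕ) (μ σ : ZMod (n + 1) → ℝ) (s : ZMod (n + 1)) : ℝ :=
  μ s - (1 / 2) * ∑ t : ZMod (n + 1), affA n s t * σ t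

theorem reflA_eq_update (n : ℕ) (μ σ : ZMod (n + 1) → ℝ) (i : ZMod (n + 1)) :
    reflA n μ i σ = Function.update σ i (σ i + 2 * dualA n μ σ i) := by
  unfold reflA dualA
  congr 1
  ring

theorem dualA_sub_dualA (n : ℕ) (μ σ τ : ZMod (n + 1) → ℝ) (s : ZMod (n + 1)) :
    dualA n μ σ s - dualA n μ τ s =
      (1 / 2) * ∑ t : ZMod (n + 1), affA n s t * (τ t - σ t) := by
  simp only [dualA, mul_sub, Finset.sum_sub_distrib]
  ring

theorem dualA_reflA (n : ℕ) (μ σ : ZMod (n + 1) → ℝ) (i s : ZMod (n + 1)) :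
    dualA n μ (reflA n μ i σ) s = dualA n μ σ s - affA n s i * dualA n μ σ i := by
  have h := dualA_sub_dualA n μ σ (reflA n μ i σ) s
  rw [Finset.sum_eq_single i] at h
  · rw [reflA_eq_update, Function.update_self] at h
    rw [reflA_eq_update]
    linarith
  · intro t _ ht
    rw [reflA_eq_update, Function.update_of_ne ht]
    ring
  · simp

theorem dualA_congr {n : ℕ} (μ : ZMod (n + 1) → ℝ) {σ τ : ZMod (n + 1) → ℝ}
    {s : ZMod (n + 1)} (h : ∀ t, affA n s t ≠ 0 → σ t = τ t) :
    dualA n μ σ s = dualA n μ τ s := by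
  unfold dualA
  congr 2
  refine Finset.sum_congr rfl fun t _ => ?_
  by_cases ht : affA n s t = 0
  · simp [ht]
  · rw [h t ht]

theorem ZMod.natCast_inj_of_lt {n a b : ℕ} (ha : a < n + 1) (hb : b < n + 1) :
    (a : ZMod (n + 1)) = b ↔ a = b := by
  rw [ZMod.natCast_eq_natCast_iff', Nat.mod_eq_of_lt ha, Nat.mod_eq_of_lt hb]

theorem ZMod.natCast_injOn_Icc {n a l : ℕ} (hl : l ≤ n) :
    Set.InjOn (fun j : ℕ => (j : ZMod (n + 1))) (Set.Icc a (a + l)) := by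
  intro x hx z hz hxz
  rw [Set.mem_Icc] at hx hz
  have h : ((x - a : ℕ) : ZMod (n + 1)) = ((z - a : ℕ) : ZMod (n + 1)) := by
    rw [Nat.cast_sub hx.1, Nat.cast_sub hz.1]
    exact congrArg (· - (a : ZMod (n + 1))) hxz
  rw [ZMod.natCast_inj_of_lt (by omega) (by omega)] at h
  omega

theorem affA_add_natCast {n : ℕ} (a : ZMod (n + 1)) {i j : ℕ} (hi : i < n) (hj : j < n) :
    affA n (a + i) (a + j) =
      if i = j then 2 else if i = j + 1 ∨ j = i + 1 then -1 else 0 := by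
  have h1 : a + (i : ZMod (n + 1)) = a + j ↔ i = j := by
    rw [add_right_inj, ZMod.natCast_inj_of_lt (by omega) (by omega)]
  have h2 : a + (i : ZMod (n + 1)) = a + j + 1 ↔ i = j + 1 := by
    rw [add_assoc, add_right_inj, ← Nat.cast_succ,
      ZMod.natCast_inj_of_lt (by omega) (by omega)]
  have h3 : a + (j : ZMod (n + 1)) = a + i + 1 ↔ j = i + 1 := by
    rw [add_assoc, add_right_inj, ← Nat.cast_succ,
      ZMod.natCast_inj_of_lt (by omega) (by omega)]
  simp only [affA, h1, h2, h3]

/-- The Weyl group of a block acts on `μ*` by permuting potentials `y` with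
`μ*_{a+j} = y_j - y_{j+1}`. -/
theorem GammaA.exists_perm_s13 {n m : ℕ} (hm : m ≤ n) (μ : ZMod (n + 1) → ℝ) (a : ZMod (n + 1))
    (w : Equiv.Perm (Fin (m + 1))) (σ : ZMod (n + 1) → ℝ) (hσ : GammaA n μ σ)
    (y : Fin (m + 1) → ℝ)
    (hy : ∀ j : Fin m, dualA n μ σ (a + (j : ℕ)) = y j.castSucc - y j.succ) :
    ∃ τ, GammaA n μ τ ∧ (∀ t, (∀ j < m, t ≠ a + (j : ℕ)) → τ t = σ t) ∧
      ∀ j : Fin m, dualA n μ τ (a + (j : ℕ)) = y (w j.castSucc) - y (w j.succ) := by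
  have hw : w ∈ Submonoid.closure
      (Set.range fun i : Fin m => Equiv.swap i.castSucc i.succ) := by
    rw [Equiv.Perm.mclosure_swap_castSucc_succ]
    trivial
  induction hw using Submonoid.closure_induction generalizing σ y with
  | mem w hw =>
    obtain ⟨i, rfl⟩ := hw
    refine ⟨reflA n μ (a + (i : ℕ)) σ, .refl _ _ hσ, fun t ht => ?_, fun j => ?_⟩
    · rw [reflA_eq_update, Function.update_of_ne (ht i i.2)]
    · rw [dualA_reflA, affA_add_natCast a (by omega) (by omega), hy, hy]
      simp only [Equiv.swap_apply_def, Fin.ext_iff, Fin.val_castSucc, Fin.val_succ]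
      have e1 : (j : ℕ) = i → j = i := Fin.ext
      have e2 : (j : ℕ) = i + 1 → j.castSucc = i.succ := fun h => Fin.ext (by simpa using h)
      have e3 : (i : ℕ) = j + 1 → i.castSucc = j.succ := fun h => Fin.ext (by simpa using h)
      have e4 : (j : ℕ) + 1 = i → i.castSucc = j.succ := fun h => e3 h.symm
      split_ifs <;> first | omega | grind
  | one => exact ⟨σ, hσ, fun _ _ => rfl, hy⟩
  | mul v w _ _ ihv ihw =>
    obtain ⟨τ, hτ, hτσ, hτy⟩ := ihv σ hσ y hy
    obtain ⟨ρ, hρ, hρτ, hρy⟩ := ihw τ hτ (y ∘ v) hτy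
    exact ⟨ρ, hρ, fun t ht => (hρτ t ht).trans (hτσ t ht), hρy⟩

/-- The longest element of the Weyl group of a block negates and reverses `μ*` on it. -/
theorem GammaA.exists_dualA_eq_neg {n m : ℕ} (hm : m ≤ n) (μ : ZMod (n + 1) → ℝ)
    (a : ZMod (n + 1)) (σ : ZMod (n + 1) → ℝ) (hσ : GammaA n μ σ) :
    ∃ τ, GammaA n μ τ ∧ (∀ t, (∀ j < m, t ≠ a + (j : ℕ)) → τ t = σ t) ∧
      ∀ j < m, dualA n μ τ (a + (j : ℕ)) = -dualA n μ σ (a + (m - 1 - j : ℕ)) := by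
  obtain ⟨τ, hτ, hτσ, hτy⟩ := exists_perm_s13 hm μ a Fin.revPerm σ hσ
    (fun k => -∑ i ∈ Finset.range k, dualA n μ σ (a + (i : ℕ)))
    (fun j => by simp [Finset.sum_range_succ])
  refine ⟨τ, hτ, hτσ, fun j hj => ?_⟩
  have h := hτy ⟨j, hj⟩
  simp only [Fin.revPerm_apply, Fin.val_rev, Fin.val_castSucc, Fin.val_succ] at h
  rw [h, show m + 1 - (j + 1) = m - 1 - j + 1 by omega,
    show m + 1 - (j + 1 + 1) = m - 1 - j by omega, Finset.sum_range_succ]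
  ring

/-- The update of a single block stays in `Γ_A(μ)`. -/
theorem GammaA.exists_block_update {n : ℕ} {μ σ : ZMod (n + 1) → ℝ} (hσ : GammaA n μ σ)
    {a l : ℕ} (hl : l < n) (k : ℕ → ℕ → ℝ)
    (hk : ∀ s ∈ Finset.Icc a (a + l), ∀ u ∈ Finset.Icc a (a + l),
      ∑ t ∈ Finset.Icc a (a + l), k s t * affA n (t : ZMod (n + 1)) (u : ZMod (n + 1))
        = if s = u then 1 else 0) :
    ∃ τ, GammaA n μ τ ∧
      (∀ t : ZMod (n + 1), (∀ j ∈ Finset.Icc a (a + l), t ≠ (j : ℕ)) → τ t = σ t) ∧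
      ∀ i ∈ Finset.Icc a (a + l), τ (i : ZMod (n + 1)) = σ (i : ZMod (n + 1)) +
        2 * ∑ j ∈ Finset.Icc a (a + l),
          k i j * (dualA n μ σ (j : ℕ) + dualA n μ σ ((2 * a + l - j : ℕ))) := by
  obtain ⟨τ, hτ, hτσ, hτd⟩ := exists_dualA_eq_neg (m := l + 1) hl μ (a : ZMod (n + 1)) σ hσ
  have hoff : ∀ t : ZMod (n + 1), (∀ j ∈ Finset.Icc a (a + l), t ≠ (j : ℕ)) → τ t = σ t := by
    intro t ht
    refine hτσ t fun j hj => ?_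
    have := ht (a + j) (Finset.mem_Icc.2 (by omega))
    push_cast at this
    exact this
  have hinj : Set.InjOn (fun j : ℕ => (j : ZMod (n + 1))) (Finset.Icc a (a + l)) := by
    rw [Finset.coe_Icc]
    exact ZMod.natCast_injOn_Icc hl.le
  refine ⟨τ, hτ, hoff, fun i hi => ?_⟩
  have key : ∀ j ∈ Finset.Icc a (a + l),
      dualA n μ σ (j : ℕ) + dualA n μ σ ((2 * a + l - j : ℕ)) =
        (1 / 2) * ∑ t ∈ Finset.Icc a (a + l),
          affA n (j : ZMod (n + 1)) (t : ZMod (n + 1)) * (τ (t : ℕ) - σ (t : ℕ)) := by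
    intro j hj
    rw [Finset.mem_Icc] at hj
    have h := hτd (j - a) (by omega)
    rw [← Nat.cast_add, ← Nat.cast_add, show a + (j - a) = j by omega,
      show a + (l + 1 - 1 - (j - a)) = 2 * a + l - j by omega] at h
    have h2 := dualA_sub_dualA n μ σ τ (j : ℕ)
    rw [h, sub_neg_eq_add] at h2
    rw [h2, ← Finset.sum_image (f := fun t : ZMod (n + 1) =>
      affA n (j : ZMod (n + 1)) t * (τ t - σ t)) hinj]
    congr 1
    symm
    refine Finset.sum_subset (Finset.subset_univ _) fun t _ ht => ?_
    rw [hoff t fun u hu htu => ht (Finset.mem_image.2 ⟨u, hu, htu.symm⟩)]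
    ring
  have hsum : ∑ j ∈ Finset.Icc a (a + l),
      k i j * (dualA n μ σ (j : ℕ) + dualA n μ σ ((2 * a + l - j : ℕ))) =
        (1 / 2) * (τ (i : ℕ) - σ (i : ℕ)) := by
    calc _ = ∑ j ∈ Finset.Icc a (a + l), ∑ t ∈ Finset.Icc a (a + l),
          (1 / 2) * (k i j * affA n (j : ZMod (n + 1)) (t : ZMod (n + 1)) *
            (τ (t : ℕ) - σ (t : ℕ))) := by
          refine Finset.sum_congr rfl fun j hj => ?_
          rw [key j hj, Finset.mul_sum, Finset.mul_sum]
          exact Finset.sum_congr rfl fun t _ => by ring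
      _ = ∑ t ∈ Finset.Icc a (a + l),
          (1 / 2) * ((if i = t then 1 else 0) * (τ (t : ℕ) - σ (t : ℕ))) := by
          rw [Finset.sum_comm]
          refine Finset.sum_congr rfl fun t ht => ?_
          rw [← Finset.mul_sum, ← Finset.sum_mul, hk i hi t ht]
      _ = _ := by
          rw [Finset.sum_eq_single_of_mem i hi fun t _ ht => by simp [ht.symm]]
          simp
  rw [hsum]
  ring

theorem affA_ne_zero_block {n a l : ℕ} (ha : 1 ≤ a) {s : ℕ}
    (hs : s ∈ Finset.Icc a (a + l)) {t : ZMod (n + 1)}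
    (ht : affA n (s : ZMod (n + 1)) t ≠ 0) :
    (∃ u ∈ Finset.Icc a (a + l), t = (u : ℕ)) ∨
      t = ((if a = 1 then n + 1 else a - 1 : ℕ) : ZMod (n + 1)) ∨
      t = ((if a + l = n + 1 then 1 else a + l + 1 : ℕ) : ZMod (n + 1)) := by
  have hn0 : ((n + 1 : ℕ) : ZMod (n + 1)) = 0 := ZMod.natCast_self _
  rw [Finset.mem_Icc] at hs
  unfold affA at ht
  split_ifs at ht with h1 h2
  · exact Or.inl ⟨s, Finset.mem_Icc.2 hs, h1.symm⟩
  · rcases h2 with h2 | h2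
    · have h3 : t = ((s - 1 : ℕ) : ZMod (n + 1)) := by
        rw [Nat.cast_sub (by omega), h2]
        simp
      by_cases h4 : s = a
      · subst h4
        refine Or.inr (Or.inl ?_)
        split_ifs with h5
        · rw [h3, hn0, h5]
          simp
        · exact h3
      · exact Or.inl ⟨s - 1, Finset.mem_Icc.2 (by omega), h3⟩
    · have h3 : t = ((s + 1 : ℕ) : ZMod (n + 1)) := by rw [h2, Nat.cast_succ]
      by_cases h4 : s = a + l
      · refine Or.inr (Or.inr ?_)
        split_ifs with h5
        · rw [h2, h4, h5, hn0]
          simp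
        · rw [h3, h4]
      · exact Or.inl ⟨s + 1, Finset.mem_Icc.2 (by omega), h3⟩
  · exact absurd rfl ht

theorem ZMod.exists_natCast_mem_Icc {n : ℕ} (t : ZMod (n + 1)) :
    ∃ u ∈ Finset.Icc 1 (n + 1), (u : ZMod (n + 1)) = t := by
  by_cases h : t.val = 0
  · refine ⟨n + 1, by simp, ?_⟩
    rw [ZMod.natCast_self, (ZMod.val_eq_zero t).1 h]
  · have := ZMod.val_lt t
    exact ⟨t.val, Finset.mem_Icc.2 (by omega), ZMod.natCast_zmod_val t⟩

/-- Alternative (I): `I = N ⊔ J_1 ⊔ ⋯ ⊔ J_ϑ` with non-wrapping consecutive blocks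
`J_p = {i_p,…,i_p+l_p}` whose cyclic neighbors lie in `N`, `N ≠ ∅`,
`{1, n+1} ∩ N ≠ ∅`.  If `σ ∈ Γ_A(μ)` and `σ*` is obtained from `σ` by the blockwise
update `σ*_i = σ_i + 2∑_{j∈J_p} k_p^{ij}(μ*_j + μ*_{2i_p+l_p-j})` (with `σ*_i = σ_i`
on `N`), then `σ* ∈ Γ_A(μ)`. -/
theorem gammaA_blockwise_step (n : ℕ) (hn : 2 ≤ n) (μ σ : ZMod (n + 1) → ℝ)
    (hσ : GammaA n μ σ)
    (μstar : ℕ → ℝ)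
    (hμstar : ∀ s : ℕ, μstar s =
      μ (s : ZMod (n + 1)) - (1 / 2) * ∑ t : ZMod (n + 1), affA n (s : ZMod (n + 1)) t * σ t)
    (ϑ : ℕ) (hϑ : 1 ≤ ϑ) (ip lp : ℕ → ℕ)
    (hblk : ∀ p ∈ Finset.Icc 1 ϑ, 1 ≤ ip p ∧ ip p + lp p ≤ n + 1)
    (hdisj : ∀ p ∈ Finset.Icc 1 ϑ, ∀ q ∈ Finset.Icc 1 ϑ, p ≠ q →
      Disjoint (Finset.Icc (ip p) (ip p + lp p)) (Finset.Icc (ip q) (ip q + lp q)))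
    (hNne : (NsetA n ϑ ip lp).Nonempty)
    (hNend : 1 ∈ NsetA n ϑ ip lp ∨ n + 1 ∈ NsetA n ϑ ip lp)
    (hnbhd : ∀ p ∈ Finset.Icc 1 ϑ,
      (if ip p = 1 then n + 1 else ip p - 1) ∈ NsetA n ϑ ip lp ∧
      (if ip p + lp p = n + 1 then 1 else ip p + lp p + 1) ∈ NsetA n ϑ ip lp)
    (kinv : ℕ → ℕ → ℕ → ℝ)
    (hkinv1 : ∀ p ∈ Finset.Icc 1 ϑ, ∀ s ∈ Finset.Icc (ip p) (ip p + lp p),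
      ∀ u ∈ Finset.Icc (ip p) (ip p + lp p),
      ∑ t ∈ Finset.Icc (ip p) (ip p + lp p),
        affA n (s : ZMod (n + 1)) (t : ZMod (n + 1)) * kinv p t u
        = if s = u then 1 else 0)
    (hkinv2 : ∀ p ∈ Finset.Icc 1 ϑ, ∀ s ∈ Finset.Icc (ip p) (ip p + lp p),
      ∀ u ∈ Finset.Icc (ip p) (ip p + lp p),
      ∑ t ∈ Finset.Icc (ip p) (ip p + lp p),
        kinv p s t * affA n (t : ZMod (n + 1)) (u : ZMod (n + 1))
        = if s = u then 1 else 0)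
    (σstar : ZMod (n + 1) → ℝ)
    (hσstar1 : ∀ s ∈ NsetA n ϑ ip lp,
      σstar (s : ZMod (n + 1)) = σ (s : ZMod (n + 1)))
    (hσstar2 : ∀ p ∈ Finset.Icc 1 ϑ, ∀ i ∈ Finset.Icc (ip p) (ip p + lp p),
      σstar (i : ZMod (n + 1)) = σ (i : ZMod (n + 1)) +
        2 * ∑ j ∈ Finset.Icc (ip p) (ip p + lp p),
          kinv p i j * (μstar j + μstar (2 * ip p + lp p - j))) :
    GammaA n μ σstar := by
  have hN : ∀ s, s ∈ NsetA n ϑ ip lp ↔ s ∈ Finset.Icc 1 (n + 1) ∧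
      ∀ p ∈ Finset.Icc 1 ϑ, s ∉ Finset.Icc (ip p) (ip p + lp p) := by
    intro s
    simp only [NsetA, Finset.mem_sdiff, Finset.mem_biUnion, not_exists, not_and]
  have hsub : ∀ p ∈ Finset.Icc 1 ϑ, ∀ s ∈ Finset.Icc (ip p) (ip p + lp p),
      s ∈ Set.Icc 1 (n + 1) := by
    intro p hp s hs
    have := hblk p hp
    rw [Finset.mem_Icc] at hs
    exact ⟨by omega, by omega⟩
  have hinj := ZMod.natCast_injOn_Icc (a := 1) (le_refl n)
  rw [add_comm 1 n] at hinj
  have main : ∀ k ≤ ϑ, ∃ τ, GammaA n μ τ ∧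
      (∀ s ∈ Finset.Icc 1 (n + 1), (∀ p ∈ Finset.Icc 1 k, s ∉ Finset.Icc (ip p) (ip p + lp p)) →
        τ (s : ℕ) = σ (s : ℕ)) ∧
      ∀ p ∈ Finset.Icc 1 k, ∀ s ∈ Finset.Icc (ip p) (ip p + lp p),
        τ (s : ℕ) = σstar (s : ℕ) := by
    intro k
    induction k with
    | zero => exact fun _ => ⟨σ, hσ, fun _ _ _ => rfl, by simp⟩
    | succ k ih =>
      intro hk
      obtain ⟨τ, hτ, hτσ, hτs⟩ := ih (by omega)
      have hq : k + 1 ∈ Finset.Icc 1 ϑ := Finset.mem_Icc.2 (by omega)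
      have hmono : ∀ p ∈ Finset.Icc 1 k, p ∈ Finset.Icc 1 ϑ ∧ p ≠ k + 1 := by
        intro p hp
        rw [Finset.mem_Icc] at hp ⊢
        omega
      obtain ⟨hq1, hq2⟩ := hblk _ hq
      obtain ⟨hL, hR⟩ := hnbhd _ hq
      have hl : lp (k + 1) < n := by
        by_contra! h
        obtain ⟨h1, h2⟩ := (hN _).1 hL
        have h3 := h2 _ hq
        rw [Finset.mem_Icc] at h1 h3
        split_ifs at h1 h3 <;> omega
      have hτN : ∀ s ∈ NsetA n ϑ ip lp, τ (s : ℕ) = σ (s : ℕ) := fun s hs =>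
        hτσ s ((hN s).1 hs).1 fun p hp => ((hN s).1 hs).2 p (hmono p hp).1
      have hτJ : ∀ s ∈ Finset.Icc (ip (k + 1)) (ip (k + 1) + lp (k + 1)),
          τ (s : ℕ) = σ (s : ℕ) := fun s hs =>
        hτσ s (Finset.mem_Icc.2 (hsub _ hq s hs)) fun p hp hsp =>
          Finset.disjoint_left.1 (hdisj p (hmono p hp).1 _ hq (hmono p hp).2) hsp hs
      have hdual : ∀ s ∈ Finset.Icc (ip (k + 1)) (ip (k + 1) + lp (k + 1)),
          dualA n μ τ (s : ℕ) = μstar s := by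
        intro s hs
        rw [hμstar]
        refine dualA_congr μ fun t ht => ?_
        rcases affA_ne_zero_block hq1 hs ht with ⟨u, hu, rfl⟩ | rfl | rfl
        · exact hτJ u hu
        · exact hτN _ hL
        · exact hτN _ hR
      obtain ⟨ρ, hρ, hρτ, hρJ⟩ := hτ.exists_block_update hl (kinv (k + 1))
        (hkinv2 _ hq)
      have hρoff : ∀ s ∈ Set.Icc 1 (n + 1),
          s ∉ Finset.Icc (ip (k + 1)) (ip (k + 1) + lp (k + 1)) → ρ (s : ℕ) = τ (s : ℕ) := by
        intro s hs hsJ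
        refine hρτ s fun j hj hsj => hsJ ?_
        rwa [hinj hs (hsub _ hq j hj) hsj]
      refine ⟨ρ, hρ, fun s hs hsJ => ?_, fun p hp s hs => ?_⟩
      · rw [hρoff s (Finset.mem_Icc.1 hs) (hsJ _ (by simp))]
        refine hτσ s hs fun p hp => hsJ p ?_
        rw [Finset.mem_Icc] at hp ⊢
        omega
      · by_cases hpk : p = k + 1
        · subst hpk
          rw [hρJ s hs, hσstar2 _ hq s hs, hτJ s hs]
          congr 2
          refine Finset.sum_congr rfl fun j hj => ?_
          rw [hdual j hj, hdual]
          rw [Finset.mem_Icc] at hj ⊢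
          omega
        · have hp' : p ∈ Finset.Icc 1 k := by
            rw [Finset.mem_Icc] at hp ⊢
            omega
          rw [hρoff s (hsub p (hmono p hp').1 s hs), hτs p hp' s hs]
          exact Finset.disjoint_left.1 (hdisj p (hmono p hp').1 _ hq hpk) hs
  obtain ⟨τ, hτ, hτσ, hτs⟩ := main ϑ le_rfl
  have : σstar = τ := by
    funext t
    obtain ⟨s, hs, rfl⟩ := ZMod.exists_natCast_mem_Icc t
    by_cases h : s ∈ NsetA n ϑ ip lp
    · rw [hσstar1 s h, hτσ s hs ((hN s).1 h).2]
    · rw [hN] at h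
      push Not at h
      obtain ⟨p, hp, hsp⟩ := h hs
      exact (hτs p hp s hsp).symm
  rwa [this]
end

section
/- Let n ≥ 2 and μ ∈ ℝ^{n+1}. Every element σ of Γ_{C^t}(μ) satisfies the type-C^t Pohozaev identity for μ, i.e. ∑_{i=1}^{n}(σ_i − σ_{i+1})² = 2(μ_1σ_1 + 2∑_{i=2}^{n} μ_iσ_i + μ_{n+1}σ_{n+1}). -/
open Finset

/-- The generalized Cartan matrix `K^c` of type `C_n^{(1),t}` (1-based indices in
`{1,…,n+1}`): `K^c_{ii} = 2`, `K^c_{1,2} = K^c_{n+1,n} = -2`,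
`K^c_{i,i-1} = K^c_{i,i+1} = -1` for `2 ≤ i ≤ n`, and `0` otherwise. -/
noncomputable def affC (n : ℕ) (i j : ℕ) : ℝ :=
  if i = j then 2
  else if (i = 1 ∧ j = 2) ∨ (i = n + 1 ∧ j = n) then -2
  else if 2 ≤ i ∧ i ≤ n ∧ (j = i - 1 ∨ j = i + 1) then -1
  else 0

/-- The affine reflection `ℜ_i` associated to `μ`:
`(ℜ_i σ)_i = 2 μ_i - ∑_{t∈I} K^c_{it} σ_t + σ_i`, other coordinates unchanged. -/
noncomputable def reflC (n : ℕ) (μ : ℕ → ℝ) (i : ℕ) (σ : ℕ → ℝ) : ℕ → ℝ :=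
  Function.update σ i
    (2 * μ i - ∑ t ∈ Finset.Icc 1 (n + 1), affC n i t * σ t + σ i)

/-- `Γ_{C^t}(μ)`: the smallest set containing `0` and closed under all `ℜ_i`, `i ∈ I`. -/
inductive GammaC (n : ℕ) (μ : ℕ → ℝ) : (ℕ → ℝ) → Prop
  | zero : GammaC n μ 0
  | refl (i : ℕ) (hi : i ∈ Finset.Icc 1 (n + 1)) (σ : ℕ → ℝ) :
      GammaC n μ σ → GammaC n μ (reflC n μ i σ)

/-- The row of `K^c` indexed by an interior node pairs with `σ` as a discrete Laplacian. -/
lemma sum_affC_interior {n i : ℕ} (hi : 2 ≤ i) (hin : i ≤ n) (σ : ℕ → ℝ) :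
    ∑ t ∈ Finset.Icc 1 (n + 1), affC n i t * σ t = 2 * σ i - σ (i - 1) - σ (i + 1) := by
  have h : ∀ t ∈ Finset.Icc 1 (n + 1), affC n i t * σ t =
      (if t = i then 2 * σ i else 0) + (if t = i - 1 then -σ (i - 1) else 0) +
        (if t = i + 1 then -σ (i + 1) else 0) := by
    intro t _
    unfold affC
    grind
  rw [Finset.sum_congr rfl h]
  simp only [Finset.sum_add_distrib, Finset.sum_ite_eq', Finset.mem_Icc]
  rw [if_pos (by omega), if_pos (by omega), if_pos (by omega)]
  ring

lemma sum_affC_first {n : ℕ} (hn : 1 ≤ n) (σ : ℕ → ℝ) :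
    ∑ t ∈ Finset.Icc 1 (n + 1), affC n 1 t * σ t = 2 * σ 1 - 2 * σ 2 := by
  have h : ∀ t ∈ Finset.Icc 1 (n + 1), affC n 1 t * σ t =
      (if t = 1 then 2 * σ 1 else 0) + (if t = 2 then -2 * σ 2 else 0) := by
    intro t _
    unfold affC
    grind
  rw [Finset.sum_congr rfl h]
  simp only [Finset.sum_add_distrib, Finset.sum_ite_eq', Finset.mem_Icc]
  rw [if_pos (by omega), if_pos (by omega)]
  ring

lemma sum_affC_last {n : ℕ} (hn : 1 ≤ n) (σ : ℕ → ℝ) :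
    ∑ t ∈ Finset.Icc 1 (n + 1), affC n (n + 1) t * σ t = 2 * σ (n + 1) - 2 * σ n := by
  have h : ∀ t ∈ Finset.Icc 1 (n + 1), affC n (n + 1) t * σ t =
      (if t = n + 1 then 2 * σ (n + 1) else 0) + (if t = n then -2 * σ n else 0) := by
    intro t _
    unfold affC
    grind
  rw [Finset.sum_congr rfl h]
  simp only [Finset.sum_add_distrib, Finset.sum_ite_eq', Finset.mem_Icc]
  rw [if_pos (by omega), if_pos (by omega)]
  ring

/-- Effect of changing one coordinate on the sum of squared consecutive differences. -/
lemma sum_sq_sub_update (n : ℕ) {i : ℕ} (hi : 1 ≤ i) (σ : ℕ → ℝ) (x : ℝ) :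
    ∑ t ∈ Finset.Icc 1 n, (Function.update σ i x t - Function.update σ i x (t + 1)) ^ 2 =
      ∑ t ∈ Finset.Icc 1 n, (σ t - σ (t + 1)) ^ 2 +
        (if i ≤ n then (x - σ (i + 1)) ^ 2 - (σ i - σ (i + 1)) ^ 2 else 0) +
        (if 2 ≤ i ∧ i ≤ n + 1 then (σ (i - 1) - x) ^ 2 - (σ (i - 1) - σ i) ^ 2 else 0) := by
  have h : ∀ t ∈ Finset.Icc 1 n,
      (Function.update σ i x t - Function.update σ i x (t + 1)) ^ 2 =
        (σ t - σ (t + 1)) ^ 2 +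
          (if t = i then (x - σ (i + 1)) ^ 2 - (σ i - σ (i + 1)) ^ 2 else 0) +
          (if t = i - 1 then (σ (i - 1) - x) ^ 2 - (σ (i - 1) - σ i) ^ 2 else 0) := by
    intro t ht
    rw [Finset.mem_Icc] at ht
    simp only [Function.update_apply]
    grind
  rw [Finset.sum_congr rfl h]
  simp only [Finset.sum_add_distrib, Finset.sum_ite_eq', Finset.mem_Icc]
  congr 2
  · simp [hi]
  · exact propext (by omega)

lemma sum_mul_update (n : ℕ) (i : ℕ) (μ σ : ℕ → ℝ) (x : ℝ) :
    ∑ t ∈ Finset.Icc 2 n, μ t * Function.update σ i x t =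
      ∑ t ∈ Finset.Icc 2 n, μ t * σ t + (if 2 ≤ i ∧ i ≤ n then μ i * (x - σ i) else 0) := by
  have h : ∀ t ∈ Finset.Icc 2 n, μ t * Function.update σ i x t =
      μ t * σ t + (if t = i then μ i * (x - σ i) else 0) := by
    intro t _
    simp only [Function.update_apply]
    grind
  rw [Finset.sum_congr rfl h]
  simp only [Finset.sum_add_distrib, Finset.sum_ite_eq', Finset.mem_Icc]

/-- Every element of `Γ_{C^t}(μ)` satisfies the type-`C^t` Pohozaev identity
`∑_{i=1}^{n}(σ_i - σ_{i+1})² = 2(μ_1σ_1 + 2∑_{i=2}^{n} μ_iσ_i + μ_{n+1}σ_{n+1})`. -/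
theorem gammaC_pohozaev (n : ℕ) (hn : 2 ≤ n) (μ σ : ℕ → ℝ) (hσ : GammaC n μ σ) :
    ∑ i ∈ Finset.Icc 1 n, (σ i - σ (i + 1)) ^ 2
      = 2 * (μ 1 * σ 1 + 2 * ∑ i ∈ Finset.Icc 2 n, μ i * σ i + μ (n + 1) * σ (n + 1)) := by
  induction hσ with
  | zero => simp
  | refl i hi σ _ ih =>
    obtain ⟨hi1, hin⟩ := Finset.mem_Icc.mp hi
    unfold reflC
    rw [sum_sq_sub_update n hi1, sum_mul_update, ih]
    rcases (by omega : i = 1 ∨ i = n + 1 ∨ (2 ≤ i ∧ i ≤ n)) with rfl | rfl | ⟨h2, hn'⟩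
    · have hne : n + 1 ≠ 1 := by omega
      rw [sum_affC_first (by omega), if_pos (by omega), if_neg (by omega), if_neg (by omega),
        Function.update_self, Function.update_of_ne hne]
      ring
    · have hne : 1 ≠ n + 1 := by omega
      rw [sum_affC_last (by omega), if_neg (by omega), if_pos (by omega), if_neg (by omega),
        Function.update_self, Function.update_of_ne hne, Nat.add_sub_cancel]
      ring
    · have hne : 1 ≠ i := by omega
      have hne' : n + 1 ≠ i := by omega
      rw [sum_affC_interior h2 hn', if_pos (by omega), if_pos (by omega), if_pos (by omega),
        Function.update_of_ne hne, Function.update_of_ne hne']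
      ring
end

section
/- Let n ≥ 2. Given σ̂, α ∈ ℝ^{n+1}, define σ, β ∈ ℝ^{2n} by σ_i = σ̂_i and β_i = α_i for 1 ≤ i ≤ n+1, and σ_i = σ̂_{2n+2−i} and β_i = α_{2n+2−i} for n+2 ≤ i ≤ 2n. Then (with σ_{2n+1} := σ_1): ∑_{i=1}^{2n}(σ_i − σ_{i+1})² = 2∑_{i=1}^{n}(σ̂_i − σ̂_{i+1})² and ∑_{i=1}^{2n}(1+β_i)σ_i = (1+α_1)σ̂_1 + 2∑_{i=2}^{n}(1+α_i)σ̂_i + (1+α_{n+1})σ̂_{n+1}. Consequently, σ satisfies the cyclic identity ∑_{i=1}^{2n}(σ_i − σ_{i+1})² = 4∑_{i=1}^{2n}(1+β_i)σ_i if and only if σ̂ satisfies the type-C^t Pohozaev identity for μ, where μ_i = 1 + α_i. -/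
open Finset

/-- Pairing each index of the first half of `{1, …, 2n}` with its mirror image. -/
theorem sum_Icc_two_mul_eq_sum_add_reflect {M : Type*} [AddCommMonoid M] (n : ℕ) (f : ℕ → M) :
    ∑ i ∈ Finset.Icc 1 (2 * n), f i = ∑ i ∈ Finset.Icc 1 n, (f i + f (2 * n + 1 - i)) := by
  have hdisj : Disjoint (Finset.Icc 1 n) (Finset.Icc (n + 1) (2 * n)) := by
    rw [Finset.disjoint_left]
    intro i hi hi'
    rw [Finset.mem_Icc] at hi hi'
    omega
  have hunion : Finset.Icc 1 (2 * n) = Finset.Icc 1 n ∪ Finset.Icc (n + 1) (2 * n) := by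
    ext i
    simp only [Finset.mem_union, Finset.mem_Icc]
    omega
  rw [hunion, Finset.sum_union hdisj, Finset.sum_add_distrib]
  congr 1
  refine Finset.sum_nbij' (fun i => 2 * n + 1 - i) (fun i => 2 * n + 1 - i) ?_ ?_ ?_ ?_ ?_
  · intro i hi
    simp only [Finset.mem_Icc] at hi ⊢
    omega
  · intro i hi
    simp only [Finset.mem_Icc] at hi ⊢
    omega
  · intro i hi
    simp only [Finset.mem_Icc] at hi ⊢
    omega
  · intro i hi
    simp only [Finset.mem_Icc] at hi ⊢
    omega
  · intro i hi
    rw [Finset.mem_Icc] at hi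
    congr 1
    omega

/-- Summing consecutive pairs counts the interior terms twice and the end terms once. -/
theorem sum_Icc_add_succ {R : Type*} [CommRing R] {n : ℕ} (hn : 1 ≤ n) (a : ℕ → R) :
    ∑ i ∈ Finset.Icc 1 n, (a i + a (i + 1)) = a 1 + 2 * ∑ i ∈ Finset.Icc 2 n, a i + a (n + 1) := by
  induction n, hn using Nat.le_induction with
  | base => simp
  | succ k hk ih =>
    rw [Finset.sum_Icc_succ_top (by omega), ih, Finset.sum_Icc_succ_top (by omega)]
    ring

/-- Unfolding a vector `σ̂ ∈ ℝ^{n+1}` (with weights `α`) to the symmetric vector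
`σ ∈ ℝ^{2n}` (`σ_i = σ̂_i` for `i ≤ n+1`, `σ_i = σ̂_{2n+2-i}` for `n+2 ≤ i ≤ 2n`)
turns the cyclic sum `∑_{i=1}^{2n}(σ_i - σ_{i+1})²` (with `σ_{2n+1} = σ_1`) into
`2∑_{i=1}^{n}(σ̂_i - σ̂_{i+1})²` and `∑_{i=1}^{2n}(1+β_i)σ_i` into
`(1+α_1)σ̂_1 + 2∑_{i=2}^{n}(1+α_i)σ̂_i + (1+α_{n+1})σ̂_{n+1}`; consequently the
cyclic identity `∑(σ_i-σ_{i+1})² = 4∑(1+β_i)σ_i` holds iff `σ̂` satisfies the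
type-`C^t` Pohozaev identity for `μ_i = 1 + α_i`. -/
theorem symmetric_unfolding_pohozaev (n : ℕ) (hn : 2 ≤ n)
    (σhat α σ β : ℕ → ℝ)
    (hσ1 : ∀ i, 1 ≤ i → i ≤ n + 1 → σ i = σhat i)
    (hβ1 : ∀ i, 1 ≤ i → i ≤ n + 1 → β i = α i)
    (hσ2 : ∀ i, n + 2 ≤ i → i ≤ 2 * n → σ i = σhat (2 * n + 2 - i))
    (hβ2 : ∀ i, n + 2 ≤ i → i ≤ 2 * n → β i = α (2 * n + 2 - i)) :
    (∑ i ∈ Finset.Icc 1 (2 * n), (σ i - σ (i % (2 * n) + 1)) ^ 2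
        = 2 * ∑ i ∈ Finset.Icc 1 n, (σhat i - σhat (i + 1)) ^ 2) ∧
    (∑ i ∈ Finset.Icc 1 (2 * n), (1 + β i) * σ i
        = (1 + α 1) * σhat 1 + 2 * ∑ i ∈ Finset.Icc 2 n, (1 + α i) * σhat i
          + (1 + α (n + 1)) * σhat (n + 1)) ∧
    ((∑ i ∈ Finset.Icc 1 (2 * n), (σ i - σ (i % (2 * n) + 1)) ^ 2
        = 4 * ∑ i ∈ Finset.Icc 1 (2 * n), (1 + β i) * σ i) ↔
      (∑ i ∈ Finset.Icc 1 n, (σhat i - σhat (i + 1)) ^ 2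
        = 2 * ((1 + α 1) * σhat 1 + 2 * ∑ i ∈ Finset.Icc 2 n, (1 + α i) * σhat i
          + (1 + α (n + 1)) * σhat (n + 1)))) := by
  have hrefl : ∀ i, 1 ≤ i → i ≤ n →
      σ (2 * n + 1 - i) = σhat (i + 1) ∧ β (2 * n + 1 - i) = α (i + 1) := by
    intro i hi hin
    rcases hin.eq_or_lt with rfl | hlt
    · rw [show 2 * i + 1 - i = i + 1 by omega]
      exact ⟨hσ1 _ (by omega) le_rfl, hβ1 _ (by omega) le_rfl⟩
    · rw [hσ2 _ (by omega) (by omega), hβ2 _ (by omega) (by omega),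
        show 2 * n + 2 - (2 * n + 1 - i) = i + 1 by omega]
      exact ⟨rfl, rfl⟩
  have hnext : ∀ i, 1 ≤ i → i ≤ n → σ ((2 * n + 1 - i) % (2 * n) + 1) = σhat i := by
    intro i hi hin
    rcases hi.eq_or_lt with rfl | hlt
    · rw [Nat.add_sub_cancel, Nat.mod_self]
      exact hσ1 _ le_rfl (by omega)
    · rw [Nat.mod_eq_of_lt (by omega),
        show 2 * n + 1 - i + 1 = 2 * n + 1 - (i - 1) by omega,
        (hrefl (i - 1) (by omega) (by omega)).1, Nat.sub_add_cancel hi]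
  have hsq : ∑ i ∈ Finset.Icc 1 (2 * n), (σ i - σ (i % (2 * n) + 1)) ^ 2
      = 2 * ∑ i ∈ Finset.Icc 1 n, (σhat i - σhat (i + 1)) ^ 2 := by
    rw [sum_Icc_two_mul_eq_sum_add_reflect, Finset.mul_sum]
    refine Finset.sum_congr rfl fun i hi => ?_
    obtain ⟨hi1, hin⟩ := Finset.mem_Icc.mp hi
    rw [hnext i hi1 hin, (hrefl i hi1 hin).1, Nat.mod_eq_of_lt (by omega),
      hσ1 i hi1 (by omega), hσ1 (i + 1) (by omega) (by omega)]
    ring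
  have hlin : ∑ i ∈ Finset.Icc 1 (2 * n), (1 + β i) * σ i
      = (1 + α 1) * σhat 1 + 2 * ∑ i ∈ Finset.Icc 2 n, (1 + α i) * σhat i
        + (1 + α (n + 1)) * σhat (n + 1) := by
    rw [sum_Icc_two_mul_eq_sum_add_reflect,
      ← sum_Icc_add_succ (by omega) fun i => (1 + α i) * σhat i]
    refine Finset.sum_congr rfl fun i hi => ?_
    obtain ⟨hi1, hin⟩ := Finset.mem_Icc.mp hi
    rw [(hrefl i hi1 hin).1, (hrefl i hi1 hin).2, hσ1 i hi1 (by omega), hβ1 i hi1 (by omega)]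
  refine ⟨hsq, hlin, ?_⟩
  rw [hsq, hlin]
  constructor <;> intro h <;> linarith
end

section
/- Let n ≥ 2, μ, σ ∈ ℝ^{n+1}, and let l ≥ 0 with l + 1 ≤ n. Consider the composition W = ℜ_{l+1}ℜ_l⋯ℜ_1 (rightmost applied first). Then (W^{l+1}σ)_s = σ_s for l+2 ≤ s ≤ n+1, and for 1 ≤ s ≤ l+1: (W^{l+1}σ)_s = 2(l+2−s)∑_{t=1}^{l+1} μ_t + 2∑_{q=0}^{l+1−s} ∑_{t=2}^{l+1−q} μ_t − 2∑_{q=0}^{l+1−s} ∑_{t=l+2−q}^{l+1} μ_t − σ_s + 2σ_{l+2}, where empty sums are 0. -/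
open Finset

theorem upChain_succ {α : Type*} (R : ℕ → α → α) (a k : ℕ) (σ : α) :
    upChain R a (k + 1) σ = R (a + k) (upChain R a k σ) := by
  induction k generalizing a σ with
  | zero => rfl
  | succ k ih =>
    rw [upChain, ih, upChain]
    congr 1
    omega

theorem reflC_apply_of_ne (n : ℕ) (μ σ : ℕ → ℝ) {i s : ℕ} (h : s ≠ i) :
    reflC n μ i σ s = σ s := by
  simp [reflC, h]

theorem reflC_apply_one {n : ℕ} (hn : 2 ≤ n) (μ σ : ℕ → ℝ) :
    reflC n μ 1 σ 1 = 2 * μ 1 - σ 1 + 2 * σ 2 := by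
  have hsum : ∑ t ∈ Icc 1 (n + 1), affC n 1 t * σ t = 2 * σ 1 - 2 * σ 2 := by
    rw [← Finset.sum_subset (s₁ := {1, 2})]
    · rw [Finset.sum_pair (by norm_num)]
      simp [affC]
      ring
    · intro t ht
      simp only [mem_insert, mem_singleton] at ht
      simp only [mem_Icc]
      omega
    · intro t _ ht
      simp only [mem_insert, mem_singleton, not_or] at ht
      have h : affC n 1 t = 0 := by
        unfold affC
        rw [if_neg (by omega), if_neg (by omega), if_neg (by omega)]
      rw [h, zero_mul]
  simp only [reflC, Function.update_self, hsum]
  ring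

theorem reflC_apply_mid {n i : ℕ} (hi : 2 ≤ i) (hin : i ≤ n) (μ σ : ℕ → ℝ) :
    reflC n μ i σ i = 2 * μ i + σ (i - 1) + σ (i + 1) - σ i := by
  have hsum : ∑ t ∈ Icc 1 (n + 1), affC n i t * σ t = 2 * σ i - σ (i - 1) - σ (i + 1) := by
    rw [← Finset.sum_subset (s₁ := {i - 1, i, i + 1})]
    · have h₁ : affC n i (i - 1) = -1 := by
        unfold affC
        rw [if_neg (by omega), if_neg (by omega), if_pos (by omega)]
      have h₂ : affC n i i = 2 := if_pos rfl
      have h₃ : affC n i (i + 1) = -1 := by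
        unfold affC
        rw [if_neg (by omega), if_neg (by omega), if_pos (by omega)]
      rw [Finset.sum_insert (by simp only [mem_insert, mem_singleton]; omega),
        Finset.sum_pair (by omega), h₁, h₂, h₃]
      ring
    · intro t ht
      simp only [mem_insert, mem_singleton] at ht
      simp only [mem_Icc]
      omega
    · intro t _ ht
      simp only [mem_insert, mem_singleton, not_or] at ht
      have h : affC n i t = 0 := by
        unfold affC
        rw [if_neg (by omega), if_neg (by omega), if_neg (by omega)]
      rw [h, zero_mul]
  simp only [reflC, Function.update_self, hsum]
  ring

theorem upChain_reflC_apply_of_lt (n : ℕ) (μ σ : ℕ → ℝ) {m s : ℕ} (hs : m < s) :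
    upChain (reflC n μ) 1 m σ s = σ s := by
  induction m with
  | zero => rfl
  | succ k ih =>
    rw [upChain_succ, reflC_apply_of_ne _ _ _ (by omega), ih (by omega)]

theorem upChain_reflC_apply {n : ℕ} (hn : 2 ≤ n) (μ σ : ℕ → ℝ) {m s : ℕ} (hm : m ≤ n)
    (hs : 1 ≤ s) (hsm : s ≤ m) :
    upChain (reflC n μ) 1 m σ s = 2 * ∑ t ∈ Icc 1 s, μ t + (σ 2 - σ 1) + σ (s + 1) := by
  induction m generalizing s with
  | zero => omega
  | succ k ih =>
    rw [upChain_succ]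
    rcases Nat.lt_or_ge s (k + 1) with h | h
    · rw [reflC_apply_of_ne _ _ _ (by omega), ih (by omega) hs (by omega)]
    · obtain rfl : s = k + 1 := by omega
      rcases Nat.eq_zero_or_pos k with rfl | hk
      · rw [reflC_apply_one hn]
        simp [upChain]
        ring
      · rw [add_comm 1 k, reflC_apply_mid (by omega) hm, Nat.add_sub_cancel,
          ih (by omega) hk le_rfl, upChain_reflC_apply_of_lt _ _ _ (by omega),
          upChain_reflC_apply_of_lt _ _ _ (by omega), Finset.sum_Icc_succ_top (by omega)]
        ring

theorem sum_Icc_succ_eq_sub (μ : ℕ → ℝ) {a b : ℕ} (h : a ≤ b) :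
    ∑ t ∈ Icc (a + 1) b, μ t = ∑ t ∈ Icc 1 b, μ t - ∑ t ∈ Icc 1 a, μ t := by
  induction b, h using Nat.le_induction with
  | base => simp
  | succ b hb ih =>
    rw [Finset.sum_Icc_succ_top (by omega), Finset.sum_Icc_succ_top (by omega), ih]
    ring

/-- A shift recursion driven by the first difference `f p 2 - f p 1`, solved along `k` steps. -/
theorem shift_recursion_add {m : ℕ} {f : ℕ → ℕ → ℝ} {M : ℕ → ℝ}
    (hf : ∀ p s, 1 ≤ s → s ≤ m → f (p + 1) s = 2 * M s + (f p 2 - f p 1) + f p (s + 1))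
    (r k s : ℕ) (hs : 1 ≤ s) (hk : s + k ≤ m + 1) :
    f (r + k) s = f r (s + k) + 2 * ∑ j ∈ range k, M (s + j)
      + ∑ j ∈ range k, (f (r + j) 2 - f (r + j) 1) := by
  induction k generalizing s with
  | zero => simp
  | succ k ih =>
    rw [← add_assoc, hf _ _ hs (by omega), ih (s + 1) (by omega) (by omega),
      Finset.sum_range_succ' (fun j => M (s + j)), Finset.sum_range_succ]
    simp only [add_assoc, add_comm 1, add_zero]
    ring

theorem shift_recursion_diff {m : ℕ} {f : ℕ → ℕ → ℝ} {M : ℕ → ℝ}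
    (hf : ∀ p s, 1 ≤ s → s ≤ m → f (p + 1) s = 2 * M s + (f p 2 - f p 1) + f p (s + 1))
    {p : ℕ} (hp : p + 1 ≤ m) :
    f p 2 - f p 1 = f 0 (p + 2) - f 0 (p + 1) + 2 * (M (p + 1) - M 1) := by
  have h₁ := shift_recursion_add hf 0 p 1 le_rfl (by omega)
  have h₂ := shift_recursion_add hf 0 p 2 (by omega) (by omega)
  have h₃ : ∑ j ∈ range p, M (2 + j) - ∑ j ∈ range p, M (1 + j) = M (p + 1) - M 1 := by
    rw [← Finset.sum_sub_distrib]
    have := Finset.sum_range_sub (fun j => M (1 + j)) p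
    simp only [← add_assoc, add_zero] at this
    rw [add_comm p 1, ← this]
    refine Finset.sum_congr rfl fun j _ => ?_
    rw [show 2 + j = 1 + j + 1 by omega]
  rw [zero_add] at h₁ h₂
  rw [h₁, h₂, add_comm 2 p, add_comm 1 p]
  linear_combination 2 * h₃

theorem shift_recursion_full {m : ℕ} {f : ℕ → ℕ → ℝ} {M : ℕ → ℝ}
    (hf : ∀ p s, 1 ≤ s → s ≤ m → f (p + 1) s = 2 * M s + (f p 2 - f p 1) + f p (s + 1))
    (htop : ∀ p, f p (m + 1) = f 0 (m + 1)) {s : ℕ} (hs : 1 ≤ s) (hsm : s ≤ m) :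
    f m s = 2 * f 0 (m + 1) - f 0 s + 2 * ∑ j ∈ range (m + 1 - s), (2 * M (s + j) - M 1) := by
  have h := shift_recursion_add hf (s - 1) (m + 1 - s) s hs (by omega)
  rw [show s - 1 + (m + 1 - s) = m by omega, show s + (m + 1 - s) = m + 1 by omega,
    htop] at h
  have hD : ∑ j ∈ range (m + 1 - s), (f (s - 1 + j) 2 - f (s - 1 + j) 1)
      = f 0 (m + 1) - f 0 s + 2 * ∑ j ∈ range (m + 1 - s), (M (s + j) - M 1) := by
    have htel := Finset.sum_range_sub (fun j => f 0 (s + j)) (m + 1 - s)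
    rw [show s + (m + 1 - s) = m + 1 by omega, add_zero] at htel
    rw [← htel, Finset.mul_sum, ← Finset.sum_add_distrib]
    refine Finset.sum_congr rfl fun j hj => ?_
    rw [mem_range] at hj
    rw [shift_recursion_diff hf (by omega), show s - 1 + j + 2 = s + (j + 1) by omega,
      show s - 1 + j + 1 = s + j by omega]
  rw [h, hD]
  simp only [Finset.sum_sub_distrib, ← Finset.mul_sum]
  ring

/-- The explicit formula for `W^{l+1} σ`, where `W = ℜ_{l+1}ℜ_l⋯ℜ_1` (rightmost
applied first, i.e. `ℜ_1` first then ascending to `ℜ_{l+1}`). -/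
theorem chainC_low_formula (n : ℕ) (hn : 2 ≤ n) (μ σ : ℕ → ℝ) (l : ℕ)
    (hl : l + 1 ≤ n) :
    (∀ s : ℕ, l + 2 ≤ s → s ≤ n + 1 →
      (upChain (reflC n μ) 1 (l + 1))^[l + 1] σ s = σ s) ∧
    (∀ s : ℕ, 1 ≤ s → s ≤ l + 1 →
      (upChain (reflC n μ) 1 (l + 1))^[l + 1] σ s =
        2 * ((l + 2 - s : ℕ) : ℝ) * ∑ t ∈ Finset.Icc 1 (l + 1), μ t
          + 2 * ∑ q ∈ Finset.range (l + 2 - s), ∑ t ∈ Finset.Icc 2 (l + 1 - q), μ t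
          - 2 * ∑ q ∈ Finset.range (l + 2 - s), ∑ t ∈ Finset.Icc (l + 2 - q) (l + 1), μ t
          - σ s + 2 * σ (l + 2)) := by
  have hfix : ∀ p s, l + 2 ≤ s → (upChain (reflC n μ) 1 (l + 1))^[p] σ s = σ s := by
    intro p s hs
    induction p with
    | zero => rfl
    | succ p ih =>
      rw [Function.iterate_succ_apply', upChain_reflC_apply_of_lt _ _ _ (by omega), ih]
  refine ⟨fun s hs _ => hfix _ s hs, fun s hs hsl => ?_⟩
  have hrec := shift_recursion_full (m := l + 1)
    (f := fun p => (upChain (reflC n μ) 1 (l + 1))^[p] σ) (M := fun k => ∑ t ∈ Icc 1 k, μ t)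
    (fun p s hs hsm => by
      simp only [Function.iterate_succ_apply']
      exact upChain_reflC_apply hn μ _ hl hs hsm)
    (fun p => hfix p _ le_rfl) hs hsl
  simp only [Function.iterate_zero, id_eq] at hrec
  rw [hrec, ← Finset.sum_range_reflect, show l + 1 + 1 - s = l + 2 - s by omega]
  have hsum : ∑ q ∈ range (l + 2 - s),
        (2 * ∑ t ∈ Icc 1 (s + (l + 2 - s - 1 - q)), μ t - ∑ t ∈ Icc 1 1, μ t)
      = ((l + 2 - s : ℕ) : ℝ) * ∑ t ∈ Icc 1 (l + 1), μ t
        + ∑ q ∈ range (l + 2 - s), ∑ t ∈ Icc 2 (l + 1 - q), μ t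
        - ∑ q ∈ range (l + 2 - s), ∑ t ∈ Icc (l + 2 - q) (l + 1), μ t := by
    have hconst : ((l + 2 - s : ℕ) : ℝ) * ∑ t ∈ Icc 1 (l + 1), μ t
        = ∑ _q ∈ range (l + 2 - s), ∑ t ∈ Icc 1 (l + 1), μ t := by simp
    rw [hconst, ← Finset.sum_add_distrib, ← Finset.sum_sub_distrib]
    refine Finset.sum_congr rfl fun q hq => ?_
    rw [mem_range] at hq
    rw [show s + (l + 2 - s - 1 - q) = l + 1 - q by omega,
      show l + 2 - q = l + 1 - q + 1 by omega,
      sum_Icc_succ_eq_sub μ (show l + 1 - q ≤ l + 1 by omega),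
      sum_Icc_succ_eq_sub μ (show 1 ≤ l + 1 - q by omega)]
    ring
  rw [hsum]
  ring
end
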